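/- Let G be a finite connected non-bipartite d-regular simple graph with g vertices and h = dg/2 edges, d ≥ 3, with adjacency matrix A. For each positive integer n let S_n = Σ_ℓ n!^{g−h} Π_{e ∈ E(G)} (n−ℓ_e)!/ℓ_e!, where the sum is over all vectors ℓ ∈ ℤ^{E(G)} with 0 ≤ ℓ_e ≤ n for all e and Σ_{e ∋ v} ℓ_e = n for every vertex v. Then, as n → ∞ along multiples of d, S_n ∼ [2(d−1)^{(d−1)g/2} / ((d(d−2))^{dg/4 − g/2} · det(A + dI)^{1/2})] · ((d−1)^{d−1}/d^{d−2})^{gn/2}. -/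

import Mathlib

section

open Real

/-- The rate function of `(n - ℓ)! / ℓ!` at `ℓ = x n`. -/
noncomputable def edgeRate (x : ℝ) : ℝ := negMulLog x - negMulLog (1 - x)

theorem edgeRate_zero : edgeRate 0 = 0 := by simp [edgeRate]

theorem edgeRate_one_sub (x : ℝ) : edgeRate (1 - x) = -edgeRate x := by
  simp [edgeRate]

theorem continuous_edgeRate : Continuous edgeRate := by
  unfold edgeRate
  fun_prop

theorem hasDerivAt_edgeRate {x : ℝ} (h0 : 0 < x) (h1 : x < 1) :
    HasDerivAt edgeRate (-log (x * (1 - x)) - 2) x := by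
  have h := (hasDerivAt_negMulLog h0.ne').sub
    ((hasDerivAt_negMulLog (x := 1 - x) (by linarith)).comp x ((hasDerivAt_id x).const_sub 1))
  refine h.congr_deriv ?_
  rw [log_mul h0.ne' (by linarith)]
  ring

theorem log_sub_four_mul_le {y z : ℝ} (hy : 0 < y) (hyz : y ≤ z) (hz : z ≤ 1 / 4) :
    log y - 4 * y ≤ log z - 4 * z := by
  have hz0 : 0 < z := hy.trans_le hyz
  have h := log_le_sub_one_of_pos (div_pos hy hz0)
  rw [log_div hy.ne' hz0.ne'] at h
  have : y / z - 1 ≤ 4 * (y - z) := by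
    rw [div_sub_one hz0.ne', div_le_iff₀ hz0]
    nlinarith
  linarith

theorem edgeRate_le_tangent {a x : ℝ} (ha0 : 0 < a) (ha : a < 1 / 2) (hx0 : 0 ≤ x)
    (hx : x ≤ 1 / 2) :
    edgeRate x ≤ edgeRate a + (-log (a * (1 - a)) - 2) * (x - a)
      - (2 - 4 / 3 * (x + 2 * a)) * (x - a) ^ 2 := by
  set L := -log (a * (1 - a)) - 2 with hL
  let k : ℝ → ℝ := fun t => edgeRate a + L * (t - a)
      - (2 - 4 / 3 * (t + 2 * a)) * (t - a) ^ 2 - edgeRate t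
  have hk : ∀ t, 0 < t → t < 1 / 2 → HasDerivAt k
      ((log (t * (1 - t)) - 4 * (t * (1 - t))) - (log (a * (1 - a)) - 4 * (a * (1 - a)))) t := by
    intro t h0 h1
    have e1 : HasDerivAt (fun t : ℝ => L * (t - a)) (L * 1) t :=
      ((hasDerivAt_id t).sub_const a).const_mul L
    have e2 : HasDerivAt (fun t : ℝ => 2 - 4 / 3 * (t + 2 * a)) (-(4 / 3 * 1)) t :=
      (((hasDerivAt_id t).add_const (2 * a)).const_mul (4 / 3)).const_sub 2
    have e3 : HasDerivAt (fun t : ℝ => (t - a) ^ 2) ((2 : ℕ) * (t - a) ^ (2 - 1) * 1) t :=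
      ((hasDerivAt_id t).sub_const a).pow 2
    have e := (((e1.const_add (edgeRate a)).sub (e2.mul e3))).sub
      (hasDerivAt_edgeRate h0 (by linarith))
    refine e.congr_deriv ?_
    rw [hL]
    push_cast
    ring
  have hkc : Continuous k := by
    have := continuous_edgeRate
    fun_prop
  have hka : k a = 0 := by simp [k]
  have hmain : 0 ≤ k x := by
    rcases le_total x a with h | h
    · have : AntitoneOn k (Set.Icc 0 a) := by
        refine antitoneOn_of_deriv_nonpos (convex_Icc _ _) hkc.continuousOn ?_ ?_
        · rw [interior_Icc]
          exact fun t ht => (hk t ht.1 (by linarith [ht.2])).differentiableAt.differentiableWithinAt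
        · rw [interior_Icc]
          intro t ht
          rw [(hk t ht.1 (by linarith [ht.2])).deriv]
          have := log_sub_four_mul_le (y := t * (1 - t)) (z := a * (1 - a))
            (mul_pos ht.1 (by linarith [ht.2])) (by nlinarith [ht.1, ht.2])
            (by nlinarith [sq_nonneg (a - 1 / 2)])
          linarith
      rw [← hka]
      exact this ⟨hx0, h⟩ ⟨ha0.le, le_rfl⟩ h
    · have : MonotoneOn k (Set.Icc a (1 / 2)) := by
        refine monotoneOn_of_deriv_nonneg (convex_Icc _ _) hkc.continuousOn ?_ ?_
        · rw [interior_Icc]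
          exact fun t ht => (hk t (by linarith [ht.1]) ht.2).differentiableAt.differentiableWithinAt
        · rw [interior_Icc]
          intro t ht
          rw [(hk t (by linarith [ht.1]) ht.2).deriv]
          have := log_sub_four_mul_le (y := a * (1 - a)) (z := t * (1 - t))
            (mul_pos ha0 (by linarith [ht.2])) (by nlinarith [ht.1, ht.2])
            (by nlinarith [sq_nonneg (t - 1 / 2)])
          linarith
      rw [← hka]
      exact this ⟨le_rfl, ha.le⟩ ⟨h, hx⟩ h
  simp only [k] at hmain
  linarith

theorem strictMonoOn_mul_edgeRate_div_sub {m : ℝ} (hm : 2 ≤ m) :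
    StrictMonoOn (fun s => m * edgeRate (s / m) - edgeRate s) (Set.Icc 0 (m / (m + 1))) := by
  have hm0 : 0 < m := by linarith
  refine strictMonoOn_of_deriv_pos (convex_Icc _ _) ?_ ?_
  · have := continuous_edgeRate
    fun_prop
  · rw [interior_Icc]
    rintro s ⟨h0, h1⟩
    have h1' : s * (m + 1) < m := by rwa [lt_div_iff₀ (by linarith)] at h1
    have hs1 : s < 1 := by nlinarith
    have hsm0 : 0 < s / m := by positivity
    have hsm1 : s / m < 1 := by rw [div_lt_one hm0]; linarith
    have h2 := ((hasDerivAt_edgeRate hsm0 hsm1).comp s ((hasDerivAt_id s).div_const m)).const_mul m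
    have h3 := h2.sub (hasDerivAt_edgeRate h0 hs1)
    have h4 : deriv (fun s => m * edgeRate (s / m) - edgeRate s) s
        = log (s * (1 - s)) - log (s / m * (1 - s / m)) := by
      refine (h3.congr_deriv ?_).deriv
      field_simp
      ring
    rw [h4, sub_pos]
    refine log_lt_log (mul_pos hsm0 (by linarith)) ?_
    have : s / m * (1 - s / m) = s * (m - s) / m ^ 2 := by field_simp
    rw [this, div_lt_iff₀ (by positivity)]
    have : m - s < (1 - s) * m ^ 2 := by nlinarith
    nlinarith

theorem sum_edgeRate_le_of_le_half {ι : Type*} (s : Finset ι) (x : ι → ℝ)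
    (hx0 : ∀ i ∈ s, 0 ≤ x i) (hx : ∑ i ∈ s, x i < 1 / 2) (hs : 2 ≤ s.card) :
    ∑ i ∈ s, edgeRate (x i) ≤ s.card * edgeRate ((∑ i ∈ s, x i) / s.card) := by
  set σ := ∑ i ∈ s, x i with hσ
  have hc : (2 : ℝ) ≤ s.card := by exact_mod_cast hs
  have hle : ∀ i ∈ s, x i ≤ σ := fun i hi => Finset.single_le_sum hx0 hi
  rcases (Finset.sum_nonneg hx0).eq_or_lt with h | h
  · rw [← hσ] at h
    have : ∀ i ∈ s, edgeRate (x i) = 0 := fun i hi => by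
      rw [le_antisymm ((hle i hi).trans h.ge) (hx0 i hi), edgeRate_zero]
    rw [Finset.sum_eq_zero this, ← h]
    simp [edgeRate_zero]
  · rw [← hσ] at h
    set a := σ / s.card with ha
    have ha0 : 0 < a := by positivity
    have ha1 : a ≤ 1 / 4 := by
      rw [ha, div_le_iff₀ (by linarith)]
      linarith
    have key : ∀ i ∈ s, edgeRate (x i) ≤ edgeRate a + (-log (a * (1 - a)) - 2) * (x i - a) := by
      intro i hi
      have h1 := hle i hi
      refine (edgeRate_le_tangent ha0 (by linarith) (hx0 i hi) (by linarith)).trans ?_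
      have : 0 ≤ (2 - 4 / 3 * (x i + 2 * a)) * (x i - a) ^ 2 :=
        mul_nonneg (by linarith) (sq_nonneg _)
      linarith
    refine (Finset.sum_le_sum key).trans_eq ?_
    rw [Finset.sum_add_distrib, ← Finset.mul_sum, Finset.sum_sub_distrib]
    simp only [Finset.sum_const, nsmul_eq_mul]
    have : (s.card : ℝ) * a = σ := by rw [ha]; field_simp
    rw [← hσ, this]
    ring

theorem exists_sum_edgeRate_le {d : ℕ} (hd : 3 ≤ d) :
    ∃ c : ℝ, 0 < c ∧ ∀ {ι : Type*} (s : Finset ι) (x : ι → ℝ), s.card = d →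
      (∀ i ∈ s, 0 ≤ x i) → ∑ i ∈ s, x i = 1 →
      ∑ i ∈ s, edgeRate (x i) ≤ d * edgeRate (1 / d) - c * ∑ i ∈ s, (x i - 1 / d) ^ 2 := by
  have hd' : (3 : ℝ) ≤ d := by exact_mod_cast hd
  have had : (1 : ℝ) / d ≤ 1 / 3 := one_div_le_one_div_of_le (by norm_num) hd'
  have had0 : (0 : ℝ) < 1 / d := by positivity
  set m : ℝ := d - 1 with hm
  have hmono := strictMonoOn_mul_edgeRate_div_sub (m := m) (by linarith)
  have hhalf : (1 : ℝ) / 2 < m / (m + 1) := by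
    rw [div_lt_div_iff₀ (by norm_num) (by linarith)]
    linarith
  have hend : m * edgeRate (m / (m + 1) / m) - edgeRate (m / (m + 1)) = d * edgeRate (1 / d) := by
    have hm1 : m + 1 = d := by rw [hm]; ring
    have e1 : m / (m + 1) / m = 1 / d := by
      have : m ≠ 0 := by linarith
      rw [hm1]
      field_simp
    have e2 : m / (m + 1) = 1 - 1 / d := by
      rw [hm1, hm]
      field_simp
    rw [e1, e2, edgeRate_one_sub, hm]
    ring
  set γ : ℝ := d * edgeRate (1 / d) - (m * edgeRate (1 / 2 / m) - edgeRate (1 / 2)) with hγ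
  have hγ0 : 0 < γ := by
    have := hmono (a := 1 / 2) ⟨by norm_num, hhalf.le⟩ ⟨by positivity, le_rfl⟩ hhalf
    simp only [hend] at this
    linarith
  refine ⟨min (4 / 9) (γ / d), by positivity, ?_⟩
  intro ι s x hs hx0 hx1
  have hle : ∀ i ∈ s, x i ≤ 1 := fun i hi => hx1 ▸ Finset.single_le_sum hx0 hi
  by_cases hcase : ∀ i ∈ s, x i ≤ 1 / 2
  · have key : ∀ i ∈ s, edgeRate (x i) ≤ edgeRate (1 / d)
        + (-log (1 / d * (1 - 1 / d)) - 2) * (x i - 1 / d)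
        - min (4 / 9) (γ / d) * (x i - 1 / d) ^ 2 := by
      intro i hi
      refine (edgeRate_le_tangent had0 (by linarith) (hx0 i hi) (hcase i hi)).trans ?_
      have h1 : min (4 / 9) (γ / d) ≤ 2 - 4 / 3 * (x i + 2 * (1 / d)) :=
        (min_le_left _ _).trans (by linarith [hcase i hi])
      have := mul_le_mul_of_nonneg_right h1 (sq_nonneg (x i - 1 / d))
      linarith
    refine (Finset.sum_le_sum key).trans_eq ?_
    rw [Finset.sum_sub_distrib, Finset.sum_add_distrib, ← Finset.mul_sum, ← Finset.mul_sum,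
      Finset.sum_sub_distrib, hx1]
    simp only [Finset.sum_const, nsmul_eq_mul, hs]
    field_simp
    ring
  · push Not at hcase
    obtain ⟨j, hj, hjx⟩ := hcase
    classical
    have hsplit := Finset.add_sum_erase s x hj
    rw [hx1] at hsplit
    have hcard : (s.erase j).card = d - 1 := by rw [Finset.card_erase_of_mem hj, hs]
    have hcard' : ((s.erase j).card : ℝ) = m := by
      rw [hcard, hm, Nat.cast_sub (by omega)]
      simp
    have h1 := sum_edgeRate_le_of_le_half (s.erase j) x
      (fun i hi => hx0 i (Finset.mem_of_mem_erase hi)) (by linarith) (by omega)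
    have hσ : ∑ i ∈ s.erase j, x i = 1 - x j := by linarith
    rw [hcard', hσ] at h1
    have h2 : edgeRate (x j) = -edgeRate (1 - x j) := by
      rw [← edgeRate_one_sub]
      congr 1
      ring
    have h3 := hmono.monotoneOn (a := 1 - x j) (b := 1 / 2)
      ⟨by linarith [hle j hj], by linarith⟩ ⟨by norm_num, hhalf.le⟩ (by linarith)
    have h4 : ∑ i ∈ s, (x i - 1 / d) ^ 2 ≤ (d : ℝ) := by
      have : ∀ i ∈ s, (x i - 1 / d) ^ 2 ≤ 1 := fun i hi => by
        have := hle i hi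
        have := hx0 i hi
        nlinarith
      refine (Finset.sum_le_sum this).trans_eq ?_
      simp [hs]
    have h5 : min (4 / 9) (γ / d) * ∑ i ∈ s, (x i - 1 / d) ^ 2 ≤ γ := by
      calc _ ≤ γ / d * d := mul_le_mul (min_le_right _ _) h4
            (Finset.sum_nonneg fun _ _ => sq_nonneg _) (by positivity)
        _ = γ := by field_simp
    have h6 := Finset.add_sum_erase s (fun i => edgeRate (x i)) hj
    linarith

open Filter Topology in
theorem tendsto_edgeRate_remainder {a : ℝ} (ha0 : 0 < a) (ha1 : a < 1) :
    Tendsto (fun u => (edgeRate (a + u) - edgeRate a - (-log (a * (1 - a)) - 2) * u) / u ^ 2)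
      (𝓝[≠] 0) (𝓝 (-((1 - 2 * a) / (2 * (a * (1 - a)))))) := by
  have hnear : ∀ᶠ u in 𝓝[≠] (0 : ℝ), 0 < a + u ∧ a + u < 1 := by
    refine nhdsWithin_le_nhds ?_
    have hc : Tendsto (fun u : ℝ => a + u) (𝓝 0) (𝓝 a) := by
      have : Continuous fun u : ℝ => a + u := by fun_prop
      simpa using this.tendsto 0
    exact (hc.eventually (lt_mem_nhds ha0)).and (hc.eventually (gt_mem_nhds ha1))
  have hb : 0 < a * (1 - a) := mul_pos ha0 (by linarith)
  refine HasDerivAt.lhopital_zero_nhdsNE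
    (f' := fun u => (-log ((a + u) * (1 - (a + u))) - 2) - (-log (a * (1 - a)) - 2))
    (g' := fun u => 2 * u) ?_ ?_ ?_ ?_ ?_ ?_
  · filter_upwards [hnear] with u hu
    have h1 := (hasDerivAt_edgeRate hu.1 hu.2).comp u ((hasDerivAt_id u).const_add a)
    have h2 := (h1.sub_const (edgeRate a)).sub
      ((hasDerivAt_id u).const_mul (-log (a * (1 - a)) - 2))
    refine h2.congr_deriv ?_
    ring
  · filter_upwards with u
    refine ((hasDerivAt_id u).pow 2).congr_deriv ?_
    simp
  · filter_upwards [self_mem_nhdsWithin] with u hu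
    simpa using hu
  · refine tendsto_nhdsWithin_of_tendsto_nhds ?_
    have : Continuous fun u => edgeRate (a + u) - edgeRate a - (-log (a * (1 - a)) - 2) * u := by
      have := continuous_edgeRate
      fun_prop
    simpa using this.tendsto 0
  · refine tendsto_nhdsWithin_of_tendsto_nhds ?_
    have : Continuous fun u : ℝ => u ^ 2 := by fun_prop
    simpa using this.tendsto 0
  · have hq : HasDerivAt (fun u : ℝ => (a + u) * (1 - (a + u))) (1 - 2 * a) 0 := by
      have h1 : HasDerivAt (fun u : ℝ => a + u) 1 0 := (hasDerivAt_id 0).const_add a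
      refine (h1.mul (h1.const_sub 1)).congr_deriv ?_
      ring
    have hl := (hq.log (by simpa using hb.ne')).fun_neg
    rw [hasDerivAt_iff_tendsto_slope_zero] at hl
    have hl2 := hl.div_const 2
    refine (hl2.congr fun u => ?_).trans_eq ?_
    · simp only [zero_add, add_zero, smul_eq_mul]
      rw [inv_mul_eq_div, div_div]
      congr 1 <;> ring
    · congr 1
      simp only [add_zero]
      field_simp

/-- The ratio of `k!` to the elementary part of Stirling's approximation, shifted so that it does
not degenerate at `k = 0`. -/
noncomputable def stirlingRatio (k : ℕ) : ℝ :=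
  (k.factorial : ℝ) / (√(k + 1) * exp (k * log k - k))

theorem stirlingRatio_pos (k : ℕ) : 0 < stirlingRatio k := by
  unfold stirlingRatio
  positivity

theorem factorial_eq_stirlingRatio_mul (k : ℕ) :
    (k.factorial : ℝ) = stirlingRatio k * √(k + 1) * exp (k * log k - k) := by
  unfold stirlingRatio
  field_simp

open Filter Topology in
theorem tendsto_stirlingRatio : Tendsto stirlingRatio atTop (𝓝 √(2 * π)) := by
  have h1 : Tendsto (fun k : ℕ => (k : ℝ) / (k + 1)) atTop (𝓝 1) := tendsto_natCast_div_add_atTop 1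
  have h2 := (Stirling.tendsto_stirlingSeq_sqrt_pi.mul ((h1.const_mul 2).sqrt))
  rw [mul_one, ← sqrt_mul pi_pos.le, mul_comm π] at h2
  refine h2.congr' ?_
  filter_upwards [eventually_gt_atTop 0] with k hk
  have hk' : (0 : ℝ) < k := by exact_mod_cast hk
  unfold Stirling.stirlingSeq stirlingRatio
  have : exp (k * log k - k) = (k / exp 1) ^ k := by
    rw [div_pow, exp_sub, ← exp_nat_mul, mul_one, ← log_pow, exp_log (by positivity)]
  rw [this, ← mul_div_assoc, sqrt_div (by positivity)]
  field_simp

theorem exists_stirlingRatio_bounds :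
    ∃ c C : ℝ, 0 < c ∧ 0 < C ∧ ∀ k, c ≤ stirlingRatio k ∧ stirlingRatio k ≤ C := by
  obtain ⟨C, hC⟩ := tendsto_stirlingRatio.bddAbove_range
  obtain ⟨c, hc⟩ := (tendsto_stirlingRatio.inv₀ (by positivity)).bddAbove_range
  have hC' : ∀ k, stirlingRatio k ≤ C := fun k => hC ⟨k, rfl⟩
  have hc' : ∀ k, (stirlingRatio k)⁻¹ ≤ c := fun k => hc ⟨k, rfl⟩
  have hc0 : 0 < c := (inv_pos.2 (stirlingRatio_pos 0)).trans_le (hc' 0)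
  exact ⟨c⁻¹, C, inv_pos.2 hc0, (stirlingRatio_pos 0).trans_le (hC' 0), fun k =>
    ⟨inv_le_of_inv_le₀ (stirlingRatio_pos k) (hc' k), hC' k⟩⟩

theorem factorial_sub_div_factorial {n l : ℕ} (hn : 0 < n) (hl : l ≤ n) :
    ((n - l).factorial : ℝ) / l.factorial =
      stirlingRatio (n - l) / stirlingRatio l * √((n - l + 1) / (l + 1)) *
        exp (n * edgeRate (l / n) + (n - 2 * l) * (log n - 1)) := by
  have hn' : (0 : ℝ) < n := by exact_mod_cast hn
  have hl' : (l : ℝ) ≤ n := by exact_mod_cast hl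
  rw [factorial_eq_stirlingRatio_mul (n - l), factorial_eq_stirlingRatio_mul l,
    sqrt_div (by linarith), Nat.cast_sub hl]
  have hlog : ∀ y : ℝ, y * log (y / n) = y * log y - y * log n := by
    intro y
    rcases eq_or_ne y 0 with rfl | hy
    · simp
    · rw [log_div hy hn'.ne']
      ring
  have key : (n : ℝ) * edgeRate (l / n) + (n - 2 * l) * (log n - 1)
      = ((n - l) * log (n - l) - (n - l)) - (l * log l - l) := by
    have e1 : (1 : ℝ) - l / n = (n - l) / n := by field_simp
    have e2 : (n : ℝ) * edgeRate (l / n) = (n - l) * log ((n - l) / n) - l * log (l / n) := by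
      unfold edgeRate negMulLog
      rw [e1]
      field_simp
      ring
    rw [e2, hlog, hlog]
    ring
  rw [key, exp_sub (_ - _) (_ - _)]
  have := stirlingRatio_pos l
  field_simp

/-- The slope of `edgeRate` at `1 / d`. -/
noncomputable def rateSlope (d : ℕ) : ℝ := -log (1 / d * (1 - 1 / d)) - 2

/-- The weight `(n - ℓ)! / ℓ!` at `n = d m`, `ℓ = m + j`, relative to its value at `j = 0` and tilted
so that its logarithm has no linear term at `j = 0`. -/
noncomputable def tiltedWeight (d m : ℕ) (j : ℤ) : ℝ :=
  if 0 ≤ (m : ℤ) + j ∧ (m : ℤ) + j ≤ d * m then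
    ((d * m - ((m : ℤ) + j).toNat).factorial : ℝ) / (((m : ℤ) + j).toNat.factorial : ℝ) /
      (((d * m - m).factorial : ℝ) / (m.factorial : ℝ)) *
      exp (j * (2 * (log (d * m) - 1) - rateSlope d))
  else 0

/-- The subexponential factor of `tiltedWeight`. -/
noncomputable def weightPrefactor (d m l : ℕ) : ℝ :=
  (stirlingRatio (d * m - l) / stirlingRatio l) / (stirlingRatio (d * m - m) / stirlingRatio m) *
    (√((d * m - l + 1) / (l + 1)) / √((d * m - m + 1) / (m + 1)))

theorem tiltedWeight_eq {d m : ℕ} {j : ℤ} (hd : 3 ≤ d) (hm : 0 < m) (h0 : 0 ≤ (m : ℤ) + j)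
    (h1 : (m : ℤ) + j ≤ d * m) :
    tiltedWeight d m j = weightPrefactor d m ((m : ℤ) + j).toNat *
      exp (d * m * (edgeRate (1 / d + j / (d * m)) - edgeRate (1 / d)) - rateSlope d * j) := by
  have hd0 : (0 : ℝ) < d := by
    have : 0 < d := by omega
    exact_mod_cast this
  have hm0 : (0 : ℝ) < m := by exact_mod_cast hm
  have hlm : m ≤ d * m := Nat.le_mul_of_pos_left m (by omega)
  obtain ⟨l, hl⟩ := Int.eq_ofNat_of_zero_le h0
  rw [tiltedWeight, if_pos ⟨h0, h1⟩, hl]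
  have hj : (j : ℝ) = l - m := by
    have : j = (l : ℤ) - m := by omega
    rw [this]
    push_cast
    ring
  have hln : l ≤ d * m := by
    have : (l : ℤ) ≤ d * m := by omega
    exact_mod_cast this
  have hn : 0 < d * m := by positivity
  simp only [Int.toNat_natCast]
  rw [factorial_sub_div_factorial hn hln, factorial_sub_div_factorial hn hlm, weightPrefactor]
  push_cast
  have e1 : (l : ℝ) / (d * m) = 1 / d + j / (d * m) := by
    rw [hj]
    field_simp
    ring
  have e2 : (m : ℝ) / (d * m) = 1 / d := by field_simp
  rw [e1, e2]
  have e3 : exp (d * m * (edgeRate (1 / d + j / (d * m)) - edgeRate (1 / d)) - rateSlope d * j)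
      = exp (d * m * edgeRate (1 / d + j / (d * m)) + (d * m - 2 * l) * (log (d * m) - 1)) /
        exp (d * m * edgeRate (1 / d) + (d * m - 2 * m) * (log (d * m) - 1)) *
        exp (j * (2 * (log (d * m) - 1) - rateSlope d)) := by
    rw [← exp_sub, ← exp_add]
    congr 1
    rw [hj]
    ring
  rw [e3]
  have := stirlingRatio_pos l
  have := stirlingRatio_pos m
  have := stirlingRatio_pos (d * m - l)
  have := stirlingRatio_pos (d * m - m)
  have : 0 < √((d * m - m + 1) / (m + 1) : ℝ) := by
    have : (m : ℝ) ≤ d * m := by exact_mod_cast hlm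
    exact sqrt_pos.2 (div_pos (by linarith) (by linarith))
  field_simp

theorem add_one_div_add_one_le {ε : ℝ} (hε : 0 < ε) {m l : ℕ} (hm : 0 < m) :
    ((m : ℝ) + 1) / (l + 1) ≤ (2 + 4 / ε) * exp (ε * ((l - m) ^ 2 / m)) := by
  have hm0 : (0 : ℝ) < m := by exact_mod_cast hm
  have hε4 : 0 < 4 / ε := by positivity
  have hl0 : (0 : ℝ) ≤ l := l.cast_nonneg
  rcases le_total (m : ℝ) (2 * l) with h | h
  · have h1 : ((m : ℝ) + 1) / (l + 1) ≤ 2 := by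
      rw [div_le_iff₀ (by positivity)]
      linarith
    have h2 : 1 ≤ exp (ε * ((l - m) ^ 2 / m)) := one_le_exp (by positivity)
    nlinarith
  · have h1 : ((m : ℝ) + 1) / (l + 1) ≤ m + 1 := div_le_self (by positivity) (by linarith)
    have h2 : (m : ℝ) / 4 ≤ (l - m) ^ 2 / m := by
      rw [le_div_iff₀ hm0]
      nlinarith
    have h3 : ε * (m / 4) + 1 ≤ exp (ε * ((l - m) ^ 2 / m)) :=
      (add_one_le_exp _).trans (exp_le_exp.2 (mul_le_mul_of_nonneg_left h2 hε.le))
    calc _ ≤ (m : ℝ) + 1 := h1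
      _ ≤ (2 + 4 / ε) * (ε * (m / 4) + 1) := by
          have : (2 + 4 / ε) * (ε * (m / 4) + 1) = m + 2 + ε * m / 2 + 4 / ε := by
            field_simp
            ring
          rw [this]
          have : 0 < ε * m / 2 := by positivity
          linarith
      _ ≤ _ := mul_le_mul_of_nonneg_left h3 (by positivity)

theorem exists_weightPrefactor_le {d : ℕ} (hd : 3 ≤ d) {ε : ℝ} (hε : 0 < ε) :
    ∃ C : ℝ, 0 < C ∧ ∀ m l : ℕ, 0 < m → l ≤ d * m →
      weightPrefactor d m l ≤ C * exp (ε * (((l : ℝ) - m) ^ 2 / m)) := by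
  obtain ⟨c, C, hc, hC, hcC⟩ := exists_stirlingRatio_bounds
  refine ⟨(C / c) / (c / C) * (1 + 2 * (2 + 4 / ε)), by positivity, fun m l hm hl => ?_⟩
  have hm0 : (0 : ℝ) < m := by exact_mod_cast hm
  have hd' : (3 : ℝ) ≤ d := by exact_mod_cast hd
  have hl' : (l : ℝ) ≤ d * m := by exact_mod_cast hl
  have hdm : 3 * (m : ℝ) ≤ d * m := mul_le_mul_of_nonneg_right hd' hm0.le
  have hl0 : (0 : ℝ) ≤ l := l.cast_nonneg
  rw [weightPrefactor, mul_assoc]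
  refine mul_le_mul ?_ ?_ (by positivity) (by positivity)
  · have h1 := hcC (d * m - l)
    have h2 := hcC l
    have h3 := hcC (d * m - m)
    have h4 := hcC m
    have := stirlingRatio_pos l
    have := stirlingRatio_pos m
    have := stirlingRatio_pos (d * m - l)
    have := stirlingRatio_pos (d * m - m)
    gcongr
    exacts [h1.2, h2.1, h3.1, h4.2]
  · rw [← sqrt_div (div_nonneg (by linarith) (by linarith))]
    set X : ℝ := (d * m - l + 1) / (l + 1) / ((d * m - m + 1) / (m + 1)) with hX
    have hX0 : 0 ≤ X := div_nonneg (div_nonneg (by linarith) (by linarith))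
      (div_nonneg (by linarith) (by linarith))
    have hsq : √X ≤ 1 + X := by
      rw [sqrt_le_left (by linarith)]
      nlinarith
    have hX1 : X ≤ 2 * ((m + 1) / (l + 1)) := by
      have e : X = ((d * m - l + 1) / (d * m - m + 1)) * ((m + 1) / (l + 1)) := by
        rw [hX]
        have : (d * m - m + 1 : ℝ) ≠ 0 := by linarith
        field_simp
      rw [e]
      refine mul_le_mul_of_nonneg_right ?_ (by positivity)
      rw [div_le_iff₀ (by linarith)]
      linarith
    have h2 : 1 ≤ exp (ε * (((l : ℝ) - m) ^ 2 / m)) := one_le_exp (by positivity)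
    have h3 := add_one_div_add_one_le hε (l := l) hm
    calc √X ≤ 1 + X := hsq
      _ ≤ 1 * exp (ε * (((l : ℝ) - m) ^ 2 / m))
          + 2 * ((2 + 4 / ε) * exp (ε * (((l : ℝ) - m) ^ 2 / m))) := by linarith
      _ = _ := by ring

open Filter Topology in
theorem tendsto_weightPrefactor {d : ℕ} (hd : 3 ≤ d) {l : ℕ → ℕ}
    (hl : Tendsto (fun m => (l m : ℝ) / m) atTop (𝓝 1)) :
    Tendsto (fun m => weightPrefactor d m (l m)) atTop (𝓝 1) := by
  have hd' : (3 : ℝ) ≤ d := by exact_mod_cast hd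
  have hmain : ∀ l : ℕ → ℕ, Tendsto (fun m => (l m : ℝ) / m) atTop (𝓝 1) →
      Tendsto (fun m => (stirlingRatio (d * m - l m) / stirlingRatio (l m)) *
        √((d * m - l m + 1) / (l m + 1))) atTop (𝓝 (√(2 * π) / √(2 * π) * √((d - 1) / 1))) := by
    intro l hl
    have hinv : Tendsto (fun m : ℕ => 1 / (m : ℝ)) atTop (𝓝 0) := tendsto_one_div_atTop_nhds_zero_nat
    have hlt : Tendsto l atTop atTop := by
      rw [← tendsto_natCast_atTop_iff (R := ℝ)]
      refine (hl.pos_mul_atTop one_pos tendsto_natCast_atTop_atTop).congr' ?_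
      filter_upwards [eventually_gt_atTop 0] with m hm
      have : (m : ℝ) ≠ 0 := by exact_mod_cast hm.ne'
      field_simp
    have hle : ∀ᶠ m in atTop, l m ≤ d * m := by
      filter_upwards [hl.eventually (gt_mem_nhds (show (1 : ℝ) < 2 by norm_num)),
        eventually_gt_atTop 0] with m h1 hm
      have hm0 : (0 : ℝ) < m := by exact_mod_cast hm
      rw [div_lt_iff₀ hm0] at h1
      have : (l m : ℝ) ≤ d * m := by nlinarith
      exact_mod_cast this
    have hsub : Tendsto (fun m => d * m - l m) atTop atTop := by
      rw [← tendsto_natCast_atTop_iff (R := ℝ)]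
      have h2 : Tendsto (fun m => (d : ℝ) - l m / m) atTop (𝓝 (d - 1)) := hl.const_sub _
      refine (h2.pos_mul_atTop (by linarith) tendsto_natCast_atTop_atTop).congr' ?_
      filter_upwards [eventually_gt_atTop 0, hle] with m hm hle
      have : (m : ℝ) ≠ 0 := by exact_mod_cast hm.ne'
      rw [Nat.cast_sub hle]
      push_cast
      field_simp
    have hA := (tendsto_stirlingRatio.comp hsub).div (tendsto_stirlingRatio.comp hlt) (by positivity)
    have hB : Tendsto (fun m => ((d : ℝ) - l m / m + 1 / m) / (l m / m + 1 / m)) atTop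
        (𝓝 ((d - 1 + 0) / (1 + 0))) :=
      ((hl.const_sub (d : ℝ)).add hinv).div (hl.add hinv) (by norm_num)
    rw [add_zero, add_zero] at hB
    have hB' : Tendsto (fun m => ((d : ℝ) * m - l m + 1) / (l m + 1)) atTop (𝓝 ((d - 1) / 1)) := by
      refine hB.congr' ?_
      filter_upwards [eventually_gt_atTop 0] with m hm
      have : (m : ℝ) ≠ 0 := by exact_mod_cast hm.ne'
      have : (l m : ℝ) + 1 ≠ 0 := by positivity
      field_simp
    exact hA.mul hB'.sqrt
  have hid : Tendsto (fun m : ℕ => (m : ℝ) / m) atTop (𝓝 1) := by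
    refine tendsto_const_nhds.congr' ?_
    filter_upwards [eventually_gt_atTop 0] with m hm
    have : (m : ℝ) ≠ 0 := by exact_mod_cast hm.ne'
    field_simp
  have hne : √(2 * π) / √(2 * π) * √(((d : ℝ) - 1) / 1) ≠ 0 := by
    have : (0 : ℝ) < (d - 1) / 1 := by linarith
    positivity
  have := (hmain l hl).div (hmain (fun m => m) hid) hne
  rw [div_self hne] at this
  refine this.congr fun m => ?_
  rw [weightPrefactor, div_mul_div_comm]
  simp only [Pi.div_apply]

open Filter Topology in
theorem tendsto_tiltedWeight {d : ℕ} (hd : 3 ≤ d) {j : ℕ → ℤ} {y : ℝ}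
    (hj : Tendsto (fun m => (j m : ℝ) / √m) atTop (𝓝 y)) :
    Tendsto (fun m => tiltedWeight d m (j m)) atTop
      (𝓝 (exp (-((d - 2) / (2 * (d - 1)) * y ^ 2)))) := by
  have hd' : (3 : ℝ) ≤ d := by exact_mod_cast hd
  have had0 : (0 : ℝ) < 1 / d := by positivity
  have had1 : (1 : ℝ) / d < 1 := by rw [div_lt_one (by linarith)]; linarith
  have hsqrt : Tendsto (fun m : ℕ => √(m : ℝ)) atTop atTop :=
    tendsto_sqrt_atTop.comp tendsto_natCast_atTop_atTop
  have hjm : Tendsto (fun m : ℕ => (j m : ℝ) / m) atTop (𝓝 0) := by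
    refine (hj.div_atTop hsqrt).congr fun m => ?_
    rw [div_div, mul_self_sqrt m.cast_nonneg]
  have hrange : ∀ᶠ m : ℕ in atTop, 0 < m ∧ 0 ≤ (m : ℤ) + j m ∧ (m : ℤ) + j m ≤ d * m := by
    filter_upwards [hjm.eventually (gt_mem_nhds one_pos),
      hjm.eventually (lt_mem_nhds (show (-1 : ℝ) < 0 by norm_num)), eventually_gt_atTop 0]
      with m h1 h2 hm
    have hm0 : (0 : ℝ) < m := by exact_mod_cast hm
    rw [div_lt_iff₀ hm0] at h1
    rw [lt_div_iff₀ hm0] at h2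
    have h1' : j m < m := by
      have : (j m : ℝ) < (m : ℤ) := by push_cast; linarith
      exact_mod_cast this
    have h2' : -(m : ℤ) < j m := by
      have : ((-(m : ℤ) : ℤ) : ℝ) < j m := by push_cast; linarith
      exact_mod_cast this
    have hd3 : (3 : ℤ) * m ≤ d * m :=
      mul_le_mul_of_nonneg_right (by exact_mod_cast hd) (by positivity)
    exact ⟨hm, by omega, by omega⟩
  set l : ℕ → ℕ := fun m => ((m : ℤ) + j m).toNat with hl
  have hlm : Tendsto (fun m => (l m : ℝ) / m) atTop (𝓝 1) := by
    have h1 : Tendsto (fun m : ℕ => 1 + (j m : ℝ) / m) atTop (𝓝 1) := by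
      simpa using hjm.const_add 1
    refine h1.congr' ?_
    filter_upwards [hrange] with m hm
    have hm0 : (m : ℝ) ≠ 0 := by exact_mod_cast hm.1.ne'
    have : (l m : ℝ) = m + j m := by
      have h2 : ((l m : ℤ) : ℝ) = ((m : ℤ) + j m : ℤ) := by rw [hl, Int.toNat_of_nonneg hm.2.1]
      push_cast at h2
      exact h2
    rw [this]
    field_simp
  have hu : Tendsto (fun m : ℕ => (j m : ℝ) / (d * m)) atTop (𝓝 0) := by
    have := hjm.div_const (d : ℝ)
    rw [zero_div] at this
    refine this.congr fun m => ?_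
    rw [div_div, mul_comm]
  have hrem := continuousAt_update_same.2 (tendsto_edgeRate_remainder had0 had1)
  have hrem' := hrem.tendsto.comp hu
  rw [Function.update_self] at hrem'
  have hexp := (hrem'.mul ((hj.pow 2).div_const (d : ℝ)))
  have hlim := (tendsto_weightPrefactor hd hlm).mul (continuous_exp.continuousAt.tendsto.comp hexp)
  have hval : 1 * exp (-((1 - 2 * (1 / (d : ℝ))) / (2 * (1 / d * (1 - 1 / d)))) * (y ^ 2 / d))
      = exp (-((d - 2) / (2 * (d - 1)) * y ^ 2)) := by
    rw [one_mul]
    congr 1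
    have : (d : ℝ) - 1 ≠ 0 := by linarith
    field_simp
  rw [hval] at hlim
  refine hlim.congr' ?_
  filter_upwards [hrange] with m hm
  have hm0 : (0 : ℝ) < m := by exact_mod_cast hm.1
  rw [tiltedWeight_eq hd hm.1 hm.2.1 hm.2.2]
  congr 1
  simp only [Function.comp_apply]
  congr 1
  rw [div_pow, sq_sqrt m.cast_nonneg, Function.update_apply]
  split_ifs with h
  · have : (j m : ℝ) = 0 := by
      rw [div_eq_zero_iff] at h
      rcases h with h | h
      · exact h
      · have : (d : ℝ) * m ≠ 0 := by positivity
        exact absurd h this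
    simp [this]
  · have : (j m : ℝ) ≠ 0 := fun h0 => h (by simp [h0])
    unfold rateSlope
    field_simp

theorem tiltedWeight_nonneg (d m : ℕ) (j : ℤ) : 0 ≤ tiltedWeight d m j := by
  unfold tiltedWeight
  split_ifs <;> positivity

/-- Gaussian domination of a product of tilted weights whose deviations sum to `0` at each vertex:
`T v` is the set of edges at `v`, each edge has two ends and each vertex has degree `d`. -/
theorem exists_prod_tiltedWeight_le {d : ℕ} (hd : 3 ≤ d) {V E : Type*} [Fintype V] [Fintype E]
    (T : V → Finset E) (hT : ∀ v, (T v).card = d)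
    (hdouble : ∀ φ : E → ℝ, ∑ v, ∑ e ∈ T v, φ e = 2 * ∑ e, φ e) :
    ∃ C c : ℝ, 0 < C ∧ 0 < c ∧ ∀ (m : ℕ) (j : E → ℤ), 0 < m → (∀ v, ∑ e ∈ T v, j e = 0) →
      ∏ e, tiltedWeight d m (j e) ≤ C * exp (-(c * ∑ e, ((j e : ℝ) ^ 2 / m))) := by
  obtain ⟨c, hc, hbound⟩ := exists_sum_edgeRate_le hd
  have hd' : (3 : ℝ) ≤ d := by exact_mod_cast hd
  obtain ⟨C, hC, hpre⟩ := exists_weightPrefactor_le hd (ε := c / d / 2) (by positivity)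
  refine ⟨C ^ Fintype.card E, c / d / 2, by positivity, by positivity, fun m j hm hj => ?_⟩
  have hm0 : (0 : ℝ) < m := by exact_mod_cast hm
  by_cases hr : ∀ e, 0 ≤ (m : ℤ) + j e ∧ (m : ℤ) + j e ≤ d * m
  swap
  · push Not at hr
    obtain ⟨e, he⟩ := hr
    rw [Finset.prod_eq_zero (Finset.mem_univ e)]
    · positivity
    · rw [tiltedWeight, if_neg]
      exact fun h => absurd h.2 (not_le.2 (he h.1))
  set x : E → ℝ := fun e => 1 / d + j e / (d * m) with hx
  have hjR : ∀ v, ∑ e ∈ T v, (j e : ℝ) = 0 := fun v => by exact_mod_cast hj v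
  have hxsum : ∀ v, ∑ e ∈ T v, x e = 1 := fun v => by
    simp only [hx, Finset.sum_add_distrib]
    rw [← Finset.sum_div _ _ ((d : ℝ) * m), hjR, Finset.sum_const, hT, nsmul_eq_mul]
    field_simp
    simp
  have hx0 : ∀ e, 0 ≤ x e := fun e => by
    have h1 : (0 : ℝ) ≤ m + j e := by exact_mod_cast (hr e).1
    have : x e = (m + j e) / (d * m) := by
      simp only [hx]
      field_simp
    rw [this]
    positivity
  have hfsum : ∑ e, edgeRate (x e) - Fintype.card E * edgeRate (1 / d)
      ≤ -(c * ∑ e, (x e - 1 / d) ^ 2) := by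
    have h1 := Finset.sum_le_sum fun v (_ : v ∈ Finset.univ) =>
      hbound (T v) x (hT v) (fun e _ => hx0 e) (hxsum v)
    rw [hdouble (fun e => edgeRate (x e)), Finset.sum_sub_distrib, ← Finset.mul_sum Finset.univ _ c,
      hdouble (fun e => (x e - 1 / d) ^ 2)] at h1
    have h2 := hdouble fun _ => edgeRate (1 / d)
    simp only [Finset.sum_const, hT, nsmul_eq_mul, Finset.card_univ] at h1 h2
    rw [← mul_assoc] at h1
    linarith
  have hjtot : ∑ e, (j e : ℝ) = 0 := by
    have := hdouble fun e => (j e : ℝ)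
    simp only [hjR, Finset.sum_const_zero] at this
    linarith
  have hfac : ∀ e, tiltedWeight d m (j e) ≤ C * exp (c / d / 2 * ((j e : ℝ) ^ 2 / m)
      + (d * m * (edgeRate (x e) - edgeRate (1 / d)) - rateSlope d * j e)) := by
    intro e
    rw [tiltedWeight_eq hd hm (hr e).1 (hr e).2, exp_add, ← mul_assoc]
    refine mul_le_mul_of_nonneg_right ?_ (exp_pos _).le
    have hln : ((m : ℤ) + j e).toNat ≤ d * m := by
      have := (hr e).2
      zify
      rw [Int.toNat_of_nonneg (hr e).1]
      exact this
    refine (hpre m _ hm hln).trans_eq ?_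
    have h2 : ((((m : ℤ) + j e).toNat : ℤ) : ℝ) = ((m : ℤ) + j e : ℤ) := by
      rw [Int.toNat_of_nonneg (hr e).1]
    push_cast at h2
    rw [h2, add_sub_cancel_left]
  calc ∏ e, tiltedWeight d m (j e)
      ≤ ∏ e, C * exp (c / d / 2 * ((j e : ℝ) ^ 2 / m)
      + (d * m * (edgeRate (x e) - edgeRate (1 / d)) - rateSlope d * j e)) :=
        Finset.prod_le_prod (fun e _ => tiltedWeight_nonneg d m (j e)) fun e _ => hfac e
    _ = C ^ Fintype.card E * exp (c / d / 2 * ∑ e, ((j e : ℝ) ^ 2 / m)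
        + d * m * (∑ e, edgeRate (x e) - Fintype.card E * edgeRate (1 / d))) := by
        rw [Finset.prod_mul_distrib, ← exp_sum, Finset.sum_add_distrib, Finset.sum_sub_distrib,
          ← Finset.mul_sum, ← Finset.mul_sum, ← Finset.mul_sum, hjtot, Finset.sum_sub_distrib]
        simp
    _ ≤ _ := by
        refine mul_le_mul_of_nonneg_left (exp_le_exp.2 ?_) (by positivity)
        have h1 := mul_le_mul_of_nonneg_left hfsum (show (0 : ℝ) ≤ d * m by positivity)
        have h2 : d * m * -(c * ∑ e, (x e - 1 / d) ^ 2) = -(c / d * ∑ e, ((j e : ℝ) ^ 2 / m)) := by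
          rw [Finset.mul_sum, Finset.mul_sum, mul_neg, Finset.mul_sum]
          congr 1
          refine Finset.sum_congr rfl fun e _ => ?_
          simp only [hx]
          field_simp
          ring
        linarith

open MeasureTheory in
theorem map_floor_volume (ι : Type*) [Fintype ι] :
    (volume : Measure (ι → ℝ)).map (fun x i => ⌊x i⌋) = Measure.count := by
  have hmeas : Measurable fun (x : ι → ℝ) (i : ι) => ⌊x i⌋ := by fun_prop
  refine Measure.ext_of_singleton fun k => ?_
  rw [Measure.map_apply hmeas (measurableSet_singleton k), Measure.count_singleton]
  have : (fun (x : ι → ℝ) (i : ι) => ⌊x i⌋) ⁻¹' {k}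
      = Set.pi Set.univ fun i => Set.Ico (k i : ℝ) (k i + 1) := by
    ext x
    simp [funext_iff, Int.floor_eq_iff]
  rw [this, volume_pi_pi]
  simp

open MeasureTheory in
theorem integral_floor_eq_tsum {ι : Type*} [Fintype ι] (f : (ι → ℤ) → ℝ)
    (hf : Integrable fun x : ι → ℝ => f fun i => ⌊x i⌋) :
    ∫ x : ι → ℝ, f (fun i => ⌊x i⌋) = ∑' k, f k := by
  have hmeas : Measurable fun (x : ι → ℝ) (i : ι) => ⌊x i⌋ := by fun_prop
  have hfm : AEStronglyMeasurable f ((volume : Measure (ι → ℝ)).map (fun x i => ⌊x i⌋)) :=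
    (measurable_of_countable f).aestronglyMeasurable
  have h1 := integral_map hmeas.aemeasurable hfm
  have h2 := (integrable_map_measure hfm hmeas.aemeasurable).2 hf
  rw [← h1, integral_countable h2, map_floor_volume]
  simp [measureReal_def]

open MeasureTheory in
theorem integrable_exp_neg_mul_sum_sq {ι : Type*} [Fintype ι] {c : ℝ} (hc : 0 < c) :
    Integrable fun x : ι → ℝ => exp (-(c * ∑ i, x i ^ 2)) := by
  have := Integrable.fintype_prod (ι := ι) (μ := fun _ => (volume : Measure ℝ))
    (f := fun _ x => exp (-c * x ^ 2)) (fun _ => integrable_exp_neg_mul_sq hc)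
  refine this.congr (Filter.Eventually.of_forall fun x => ?_)
  simp only
  rw [← exp_sum, Finset.mul_sum, ← Finset.sum_neg_distrib]
  simp

open MeasureTheory in
theorem integral_exp_neg_sum_sq (ι : Type*) [Fintype ι] :
    ∫ x : ι → ℝ, exp (-∑ i, x i ^ 2) = √π ^ Fintype.card ι := by
  have h := integral_fintype_prod_volume_eq_pow (ι := ι) (fun x : ℝ => exp (-1 * x ^ 2))
  rw [integral_gaussian, div_one] at h
  rw [← h]
  congr 1
  funext x
  rw [← exp_sum, ← Finset.sum_neg_distrib]
  simp

open MeasureTheory Matrix MatrixOrder in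
theorem integral_exp_neg_posDef {ι : Type*} [Fintype ι] [DecidableEq ι] {Q : Matrix ι ι ℝ}
    (hQ : Q.PosDef) :
    ∫ x : ι → ℝ, exp (-(x ⬝ᵥ Q *ᵥ x)) = √π ^ Fintype.card ι / √Q.det := by
  have hQ' := hQ.posSemidef
  set T := CFC.sqrt Q with hT
  have hTT : T * T = Q := CFC.sqrt_mul_sqrt_self Q hQ'.nonneg
  have hTs : Tᵀ = T := by
    have : T.PosSemidef := (CFC.sqrt_nonneg Q).posSemidef
    simpa [IsHermitian, conjTranspose_eq_transpose_of_trivial] using this.isHermitian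
  have hdet : T.det = √Q.det := by
    rw [hT, hQ'.det_sqrt]
    simp
  have hdet0 : T.det ≠ 0 := by
    rw [hdet]
    exact (sqrt_pos.2 hQ.det_pos).ne'
  have hquad : ∀ x : ι → ℝ, x ⬝ᵥ Q *ᵥ x = ∑ i, (toLin' T x) i ^ 2 := by
    intro x
    rw [← hTT, ← mulVec_mulVec, dotProduct_mulVec, ← mulVec_transpose, hTs, toLin'_apply]
    simp [dotProduct, sq]
  have hmeas : Measurable (toLin' T) := (LinearMap.continuous_of_finiteDimensional _).measurable
  have h1 := integral_map (μ := (volume : Measure (ι → ℝ))) hmeas.aemeasurable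
    (f := fun y : ι → ℝ => exp (-∑ i, y i ^ 2))
    (by
      have : Continuous fun y : ι → ℝ => exp (-∑ i, y i ^ 2) := by fun_prop
      exact this.aestronglyMeasurable)
  simp only [hquad]
  rw [← h1, Real.map_matrix_volume_pi_eq_smul_volume_pi hdet0, integral_smul_measure,
    integral_exp_neg_sum_sq, hdet, ENNReal.toReal_ofReal (abs_nonneg _), abs_of_nonneg (by positivity),
    smul_eq_mul, inv_mul_eq_div]

open MeasureTheory Filter Topology in
/-- A lattice sum with Gaussian domination converges, after scaling, to the integral of its
pointwise limit. -/
theorem tendsto_tsum_div_sqrt_pow {ι : Type*} [Fintype ι] {F : ℕ → (ι → ℤ) → ℝ}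
    {φ : (ι → ℝ) → ℝ} {C c : ℝ} (hC : 0 ≤ C) (hc : 0 < c)
    (hbound : ∀ m : ℕ, 0 < m → ∀ k, |F m k| ≤ C * exp (-(c * ∑ i, (k i : ℝ) ^ 2 / m)))
    (hlim : ∀ (x : ι → ℝ) (k : ℕ → ι → ℤ),
      (∀ i, Tendsto (fun m => (k m i : ℝ) / √m) atTop (𝓝 (x i))) →
        Tendsto (fun m => F m (k m)) atTop (𝓝 (φ x))) :
    Tendsto (fun m : ℕ => (∑' k, F m k) / √m ^ Fintype.card ι) atTop (𝓝 (∫ x, φ x)) := by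
  set K := Fintype.card ι with hK
  have hmeas : ∀ m : ℕ, AEStronglyMeasurable (fun x : ι → ℝ => F m fun i => ⌊√m * x i⌋)
      (volume : Measure (ι → ℝ)) := fun m =>
    ((measurable_of_countable (F m)).comp (by fun_prop)).aestronglyMeasurable
  have hdom : Integrable fun x : ι → ℝ => C * exp (c * K) * exp (-(c / 2 * ∑ i, x i ^ 2)) :=
    (integrable_exp_neg_mul_sum_sq (by positivity)).const_mul _
  have hle : ∀ m : ℕ, 0 < m → ∀ x : ι → ℝ, ‖F m fun i => ⌊√m * x i⌋‖
      ≤ C * exp (c * K) * exp (-(c / 2 * ∑ i, x i ^ 2)) := by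
    intro m hm x
    have hm1 : (1 : ℝ) ≤ m := by exact_mod_cast hm
    have hm0 : (0 : ℝ) < m := by linarith
    rw [norm_eq_abs]
    refine (hbound m hm _).trans ?_
    rw [mul_assoc, ← exp_add]
    refine mul_le_mul_of_nonneg_left (exp_le_exp.2 ?_) hC
    have hone : ∀ i, x i ^ 2 / 2 - 1 ≤ (⌊√m * x i⌋ : ℝ) ^ 2 / m := by
      intro i
      set f : ℝ := ((⌊√m * x i⌋ : ℤ) : ℝ) with hf
      have h1 : f ≤ √m * x i := Int.floor_le _
      have h2 : √m * x i < f + 1 := Int.lt_floor_add_one _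
      have h3 : (√m * x i) ^ 2 = m * x i ^ 2 := by rw [mul_pow, sq_sqrt hm0.le]
      rw [le_div_iff₀ hm0]
      have h4 : (√m * x i - f) ^ 2 ≤ 1 := by nlinarith
      nlinarith [sq_nonneg (2 * f - √m * x i)]
    have hsum := Finset.sum_le_sum fun i (_ : i ∈ Finset.univ) => hone i
    rw [Finset.sum_sub_distrib, ← Finset.sum_div, Finset.sum_const, nsmul_eq_mul, mul_one,
      Finset.card_univ, ← hK] at hsum
    have := mul_le_mul_of_nonneg_left hsum hc.le
    linarith
  have hptw : ∀ x : ι → ℝ, Tendsto (fun m : ℕ => F m fun i => ⌊√m * x i⌋) atTop (𝓝 (φ x)) := by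
    intro x
    refine hlim x (fun (m : ℕ) i => ⌊√m * x i⌋) fun i => ?_
    have hsqrt : Tendsto (fun m : ℕ => √(m : ℝ)) atTop atTop :=
      tendsto_sqrt_atTop.comp tendsto_natCast_atTop_atTop
    have h1 := (tendsto_const_nhds (x := (1 : ℝ))).div_atTop hsqrt
    have h2 : Tendsto (fun m : ℕ => x i - 1 / √m) atTop (𝓝 (x i)) := by
      simpa using h1.const_sub (x i)
    refine tendsto_of_tendsto_of_tendsto_of_le_of_le' h2 tendsto_const_nhds ?_ ?_
    · filter_upwards [eventually_gt_atTop 0] with m hm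
      have : 0 < √(m : ℝ) := sqrt_pos.2 (by exact_mod_cast hm)
      rw [le_div_iff₀ this, sub_mul, div_mul_cancel₀ _ this.ne']
      linarith [Int.lt_floor_add_one (√m * x i)]
    · filter_upwards [eventually_gt_atTop 0] with m hm
      have : 0 < √(m : ℝ) := sqrt_pos.2 (by exact_mod_cast hm)
      rw [div_le_iff₀ this]
      linarith [Int.floor_le (√m * x i)]
  have hDCT := tendsto_integral_filter_of_dominated_convergence
    (μ := (volume : Measure (ι → ℝ))) _ (Eventually.of_forall hmeas)
    ((eventually_gt_atTop 0).mono fun m hm => Eventually.of_forall (hle m hm)) hdom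
    (Eventually.of_forall hptw)
  refine hDCT.congr' ?_
  filter_upwards [eventually_gt_atTop 0] with m hm
  have hm0 : 0 < √(m : ℝ) := sqrt_pos.2 (by exact_mod_cast hm)
  have hint : Integrable fun x : ι → ℝ => F m fun i => ⌊√m * x i⌋ :=
    hdom.mono' (hmeas m) (Eventually.of_forall (hle m hm))
  have hint' : Integrable fun x : ι → ℝ => F m fun i => ⌊x i⌋ :=
    (integrable_comp_smul_iff volume (fun x : ι → ℝ => F m fun i => ⌊x i⌋) hm0.ne').1
      (by simpa using hint)
  have hscale := Measure.integral_comp_smul (volume : Measure (ι → ℝ))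
    (fun x : ι → ℝ => F m fun i => ⌊x i⌋) √(m : ℝ)
  simp only [Pi.smul_apply, smul_eq_mul, Module.finrank_fintype_fun_eq_card] at hscale
  rw [hscale, integral_floor_eq_tsum _ hint', abs_of_pos (by positivity), inv_mul_eq_div]

open Matrix in
/-- The determinant identity for the kernel lattice of a split surjection `P` with section `C`,
kernel basis `B` and kernel coordinates `R`. -/
theorem det_transpose_mul_eq_of_split {V E K : Type*} [Fintype V] [Fintype E] [Fintype K]
    [DecidableEq V] [DecidableEq E] [DecidableEq K] {P : Matrix V E ℤ} {C : Matrix E V ℤ}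
    {B : Matrix E K ℤ} {R : Matrix K E ℤ} (hPC : P * C = 1) (hPB : P * B = 0) (hRC : R * C = 0)
    (hRB : R * B = 1) (hsum : C * P + B * R = 1) :
    Fintype.card E = Fintype.card V + Fintype.card K ∧ (P * Pᵀ).det = (Bᵀ * B).det := by
  set U : Matrix E (V ⊕ K) ℤ := fromCols C B with hU
  set W : Matrix (V ⊕ K) E ℤ := fromRows P R with hW
  have hUW : U * W = 1 := by rw [hU, hW, fromCols_mul_fromRows, hsum]
  have hWU : W * U = 1 := by
    rw [hU, hW, fromRows_mul_fromCols, hPC, hPB, hRC, hRB, fromBlocks_one]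
  have hcard : Fintype.card E = Fintype.card (V ⊕ K) := by
    have h := (toLin'OfInv hUW hWU).finrank_eq
    simpa [add_comm] using h
  refine ⟨by rw [hcard, Fintype.card_sum], ?_⟩
  have hdetU : (Uᵀ * U).det = 1 := by
    let e : E ≃ V ⊕ K := Fintype.equivOfCardEq hcard
    set U' : Matrix (V ⊕ K) (V ⊕ K) ℤ := U.submatrix e.symm id with hU'
    have h1 : Uᵀ * U = U'ᵀ * U' := by
      rw [hU', transpose_submatrix, submatrix_mul_equiv, submatrix_id_id]
    have h2 : U' * W.submatrix id e.symm = 1 := by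
      rw [hU', ← submatrix_mul _ _ _ id _ Function.bijective_id, hUW, submatrix_one_equiv]
    have h3 : IsUnit U'.det := by
      have h := congrArg det h2
      rw [det_mul, det_one] at h
      exact IsUnit.of_mul_eq_one _ h
    rw [h1, det_mul, det_transpose]
    rcases Int.isUnit_iff.1 h3 with h | h <;> simp [h]
  have hblock : Uᵀ * U * fromBlocks (P * Pᵀ) 0 (R * Pᵀ) 1 = fromBlocks 1 (Cᵀ * B) 0 (Bᵀ * B) := by
    rw [hU, transpose_fromCols, fromRows_mul_fromCols, fromBlocks_multiply]
    have keyV : ∀ X : Matrix V E ℤ, X * C * (P * Pᵀ) + X * B * (R * Pᵀ) = X * Pᵀ := by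
      intro X
      simp only [Matrix.mul_assoc, ← Matrix.mul_add]
      rw [← Matrix.mul_assoc C, ← Matrix.mul_assoc B, ← Matrix.add_mul, hsum, Matrix.one_mul]
    have keyK : ∀ X : Matrix K E ℤ, X * C * (P * Pᵀ) + X * B * (R * Pᵀ) = X * Pᵀ := by
      intro X
      simp only [Matrix.mul_assoc, ← Matrix.mul_add]
      rw [← Matrix.mul_assoc C, ← Matrix.mul_assoc B, ← Matrix.add_mul, hsum, Matrix.one_mul]
    rw [keyV, keyK, ← transpose_mul, hPC, ← transpose_mul, hPB]
    simp
  have h := congrArg det hblock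
  rw [det_mul, hdetU, det_fromBlocks_zero₁₂, det_fromBlocks_zero₂₁] at h
  simpa using h

open Matrix in
theorem exists_kernel_lattice {V E : Type*} [Fintype V] [Fintype E] [DecidableEq V] [DecidableEq E]
    {M : Matrix V E ℤ} {N : Matrix V V ℤ} (hN : N.det ≠ 0)
    (hMN : Set.range M.mulVec = Set.range N.mulVec) :
    ∃ (r : ℕ) (B : Matrix E (Fin r) ℤ) (R : Matrix (Fin r) E ℤ),
      Fintype.card E = Fintype.card V + r ∧ M * B = 0 ∧ R * B = 1 ∧
      (∀ l, M *ᵥ l = 0 → B *ᵥ (R *ᵥ l) = l) ∧ (M * Mᵀ).det = N.det ^ 2 * (Bᵀ * B).det := by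
  have hinj : Function.Injective N.mulVec := by
    intro x y hxy
    have h0 : N *ᵥ (x - y) = 0 := by rw [mulVec_sub]; exact sub_eq_zero.2 hxy
    exact sub_eq_zero.1 (eq_zero_of_mulVec_eq_zero hN h0)
  have hP : ∀ e : E, ∃ p : V → ℤ, N *ᵥ p = M *ᵥ Pi.single e 1 := fun e => by
    have : M *ᵥ Pi.single e 1 ∈ Set.range N.mulVec := hMN ▸ ⟨_, rfl⟩
    exact this
  choose p hp using hP
  set P : Matrix V E ℤ := (of p)ᵀ with hPdef
  have hNP : M = N * P := by
    refine Matrix.ext_of_mulVec_single fun e => ?_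
    rw [← mulVec_mulVec, ← hp e]
    congr 1
    rw [hPdef]
    ext v
    simp
  have hC : ∀ v : V, ∃ c : E → ℤ, P *ᵥ c = Pi.single v 1 := fun v => by
    have : N *ᵥ Pi.single v 1 ∈ Set.range M.mulVec := hMN ▸ ⟨_, rfl⟩
    obtain ⟨c, hc⟩ := this
    refine ⟨c, hinj ?_⟩
    change M *ᵥ c = _ at hc
    rw [← hc, hNP, ← mulVec_mulVec]
  choose c hc using hC
  set C : Matrix E V ℤ := (of c)ᵀ with hCdef
  have hPC : P * C = 1 := by
    refine Matrix.ext_of_mulVec_single fun v => ?_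
    rw [← mulVec_mulVec, one_mulVec]
    refine Eq.trans ?_ (hc v)
    congr 1
    rw [hCdef]
    ext e
    simp
  let Λ : Submodule ℤ (E → ℤ) := LinearMap.ker P.mulVecLin
  let b := Module.finBasis ℤ Λ
  have hres : ∀ l, (LinearMap.id - (C * P).mulVecLin : (E → ℤ) →ₗ[ℤ] (E → ℤ)) l ∈ Λ := by
    intro l
    simp only [Λ, LinearMap.mem_ker, mulVecLin_apply, LinearMap.sub_apply, LinearMap.id_apply,
      mulVec_sub, mulVec_mulVec]
    rw [← Matrix.mul_assoc, hPC, Matrix.one_mul, sub_self]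
  let ρ : (E → ℤ) →ₗ[ℤ] Λ := LinearMap.codRestrict Λ _ hres
  let B := LinearMap.toMatrix' (Λ.subtype ∘ₗ b.equivFun.symm.toLinearMap)
  let R := LinearMap.toMatrix' (b.equivFun.toLinearMap ∘ₗ ρ)
  have hB : ∀ x, B *ᵥ x = (b.equivFun.symm x : E → ℤ) := fun x => by
    simp [B, LinearMap.toMatrix'_mulVec]
  have hR : ∀ l, R *ᵥ l = b.equivFun (ρ l) := fun l => by
    simp only [R, LinearMap.toMatrix'_mulVec]
    rfl
  have hρ : ∀ l, (ρ l : E → ℤ) = l - (C * P) *ᵥ l := fun l => rfl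
  have hPBv : ∀ x, P *ᵥ (B *ᵥ x) = 0 := fun x => by
    rw [hB]
    exact LinearMap.mem_ker.1 (b.equivFun.symm x).2
  have hPB : P * B = 0 := Matrix.ext_of_mulVec_single fun i => by
    rw [← mulVec_mulVec, hPBv, zero_mulVec]
  have hsum : C * P + B * R = 1 := Matrix.ext_of_mulVec_single fun i => by
    rw [add_mulVec, ← mulVec_mulVec _ B R, hB, hR, LinearEquiv.symm_apply_apply, hρ, one_mulVec]
    abel
  have hρB : ∀ x, ρ (B *ᵥ x) = b.equivFun.symm x := fun x => by
    refine Subtype.ext ?_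
    rw [hρ, ← mulVec_mulVec, hPBv, mulVec_zero, sub_zero, hB]
  have hRB : R * B = 1 := Matrix.ext_of_mulVec_single fun i => by
    rw [← mulVec_mulVec, hR, hρB, LinearEquiv.apply_symm_apply, one_mulVec]
  have hRC : R * C = 0 := Matrix.ext_of_mulVec_single fun i => by
    rw [← mulVec_mulVec, hR, zero_mulVec]
    have : ρ (C *ᵥ Pi.single i 1) = 0 := by
      refine Subtype.ext ?_
      rw [hρ, mulVec_mulVec, Matrix.mul_assoc, hPC, Matrix.mul_one, sub_self]
      rfl
    rw [this, map_zero]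
  obtain ⟨hcard, hdet⟩ := det_transpose_mul_eq_of_split hPC hPB hRC hRB hsum
  refine ⟨_, B, R, by simpa using hcard, ?_, hRB, ?_, ?_⟩
  · rw [hNP, Matrix.mul_assoc, hPB, Matrix.mul_zero]
  · intro l hl
    have hPl : P *ᵥ l = 0 := by
      rw [hNP, ← mulVec_mulVec] at hl
      exact eq_zero_of_mulVec_eq_zero hN hl
    rw [hR, hB, LinearEquiv.symm_apply_apply, hρ, ← mulVec_mulVec, hPl, mulVec_zero, sub_zero]
  · rw [← hdet, hNP, transpose_mul, Matrix.mul_assoc, ← Matrix.mul_assoc P, det_mul, det_mul,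
      det_transpose]
    ring

section

open Matrix

/-- The unsigned incidence matrix of `G`, with columns indexed by the edges of `G`. -/
def edgeIncMatrix {V : Type*} [DecidableEq V] (G : SimpleGraph V) : Matrix V G.edgeSet ℤ :=
  of fun v e => if v ∈ (e : Sym2 V) then 1 else 0

theorem sum_ite_mem_sym2 {V R : Type*} [Fintype V] [DecidableEq V] [NonAssocSemiring R]
    {e : Sym2 V} (he : ¬ e.IsDiag) (c : R) : (∑ v, if v ∈ e then c else 0) = 2 * c := by
  induction e with | _ a b
  have hab : a ≠ b := by simpa using he
  have hfilter : (Finset.univ.filter fun v => v ∈ s(a, b)) = {a, b} := by ext; simp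
  rw [← Finset.sum_filter, hfilter, Finset.sum_pair hab, two_mul]

theorem card_filter_mem_edgeSet {V : Type*} [Fintype V] [DecidableEq V] (G : SimpleGraph V)
    [DecidableRel G.Adj] (v : V) :
    (Finset.univ.filter fun e : G.edgeSet => v ∈ (e : Sym2 V)).card = G.degree v := by
  rw [← G.card_incidenceFinset_eq_degree v, ← Finset.card_map (Function.Embedding.subtype _)]
  congr 1
  ext e
  simp [SimpleGraph.mem_incidenceFinset, SimpleGraph.incidenceSet, and_comm]

theorem edgeIncMatrix_mul_transpose {V : Type*} [Fintype V] [DecidableEq V] (G : SimpleGraph V)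
    [DecidableRel G.Adj] {d : ℕ} (hreg : G.IsRegularOfDegree d) :
    edgeIncMatrix G * (edgeIncMatrix G)ᵀ = G.adjMatrix ℤ + (d : ℤ) • (1 : Matrix V V ℤ) := by
  ext v w
  simp only [edgeIncMatrix, mul_apply, transpose_apply, of_apply, mul_ite, mul_one, mul_zero,
    ← ite_and, Matrix.add_apply, Matrix.smul_apply, SimpleGraph.adjMatrix_apply, Finset.sum_boole]
  by_cases hvw : v = w
  · subst hvw
    simp [card_filter_mem_edgeSet, hreg.degree_eq v]
  by_cases hadj : G.Adj v w
  · have : (Finset.univ.filter fun e : G.edgeSet => w ∈ (e : Sym2 V) ∧ v ∈ (e : Sym2 V)) =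
        {⟨s(v, w), hadj⟩} := by
      ext e
      simp [and_comm, Sym2.mem_and_mem_iff hvw, Subtype.ext_iff]
    simp [this, hvw, hadj]
  · have : (Finset.univ.filter fun e : G.edgeSet => w ∈ (e : Sym2 V) ∧ v ∈ (e : Sym2 V)) = ∅ := by
      ext e
      simp only [Finset.mem_filter, Finset.mem_univ, true_and, Finset.notMem_empty, iff_false]
      rw [and_comm, Sym2.mem_and_mem_iff hvw]
      rintro he
      exact hadj (by simpa [he] using e.2)
    simp [this, hvw, hadj]

theorem single_sub_single_mem_range_edgeIncMatrix {V : Type*} [Fintype V] [DecidableEq V]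
    {G : SimpleGraph V} [DecidableRel G.Adj] {u v : V} (p : G.Walk u v) :
    (Pi.single u 1 - (-1) ^ p.length • Pi.single v 1 : V → ℤ) ∈
      LinearMap.range (edgeIncMatrix G).mulVecLin := by
  induction p with
  | nil => simp
  | @cons u w v hadj p ih =>
    have hedge : (Pi.single u 1 + Pi.single w 1 : V → ℤ) ∈
        LinearMap.range (edgeIncMatrix G).mulVecLin := by
      refine ⟨Pi.single ⟨s(u, w), hadj⟩ 1, ?_⟩
      ext x
      have := hadj.ne
      by_cases hu : x = u <;> by_cases hw : x = w <;>
        simp_all [edgeIncMatrix]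
    convert Submodule.sub_mem _ hedge ih using 1
    rw [SimpleGraph.Walk.length_cons, pow_succ]
    simp
    abel

/-- For a connected non-bipartite graph, the incidence matrix maps onto the vectors with even
coordinate sum. -/
theorem range_edgeIncMatrix {V : Type*} [Fintype V] [DecidableEq V]
    {G : SimpleGraph V} [DecidableRel G.Adj] (hconn : G.Connected) (hnb : ¬ G.Colorable 2) :
    Set.range (edgeIncMatrix G).mulVec = {y | Even (∑ v, y v)} := by
  set L := LinearMap.range (edgeIncMatrix G).mulVecLin with hL
  ext y
  constructor
  · rintro ⟨l, rfl⟩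
    have : ∑ v, ((edgeIncMatrix G) *ᵥ l) v = 2 * ∑ e, l e := by
      simp only [mulVec, dotProduct, edgeIncMatrix, of_apply, ite_mul, one_mul, zero_mul]
      rw [Finset.sum_comm, Finset.mul_sum]
      exact Finset.sum_congr rfl fun e _ => sum_ite_mem_sym2 (G.not_isDiag_of_mem_edgeSet e.2) _
    change Even (∑ v, ((edgeIncMatrix G) *ᵥ l) v)
    exact this ▸ even_two_mul _
  · intro hy
    rw [SimpleGraph.two_colorable_iff_forall_loop_even] at hnb
    push Not at hnb
    obtain ⟨u, w, hw⟩ := hnb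
    have h2 : (2 : ℤ) • (Pi.single u 1 : V → ℤ) ∈ L := by
      have := single_sub_single_mem_range_edgeIncMatrix w
      rw [(Nat.not_even_iff_odd.1 hw).neg_one_pow] at this
      convert this using 1
      rw [neg_one_smul, sub_neg_eq_add, two_smul]
    have h1 : ∀ v, (Pi.single v 1 - Pi.single u 1 : V → ℤ) ∈ L := fun v => by
      obtain ⟨p⟩ := hconn.preconnected v u
      have hp := single_sub_single_mem_range_edgeIncMatrix p
      rcases neg_one_pow_eq_or ℤ p.length with h | h
      · rwa [h, one_smul] at hp
      · convert L.sub_mem hp h2 using 1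
        rw [h, neg_one_smul, two_smul]
        abel
    obtain ⟨k, hk⟩ := hy
    have hdecomp : y = ∑ v, y v • (Pi.single v 1 - Pi.single u 1 : V → ℤ) +
        k • (2 : ℤ) • (Pi.single u 1 : V → ℤ) := by
      simp only [smul_sub, Finset.sum_sub_distrib, ← Finset.sum_smul, hk]
      rw [smul_smul, mul_two, sub_add_cancel]
      ext x
      simp [Finset.sum_apply, Pi.single_apply]
    have : y ∈ L := by
      rw [hdecomp]
      exact L.add_mem (L.sum_mem fun v _ => L.smul_mem _ (h1 v)) (L.smul_mem _ h2)
    exact this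

/-- The vectors with even coordinate sum are the range of an integer matrix of determinant two. -/
theorem exists_range_mulVec_eq_even {V : Type*} [Fintype V] [DecidableEq V] [Nonempty V] :
    ∃ N : Matrix V V ℤ, N.det = 2 ∧ Set.range N.mulVec = {y | Even (∑ v, y v)} := by
  classical
  obtain ⟨v₀⟩ := ‹Nonempty V›
  set N : Matrix V V ℤ := (1 : Matrix V V ℤ).updateRow v₀ (fun v => if v = v₀ then 2 else -1)
    with hN
  have hrow : ∀ x, (N *ᵥ x) v₀ = 3 * x v₀ - ∑ v, x v := fun x => by
    have : ∀ v, (if v = v₀ then (2:ℤ) else -1) * x v = (if v = v₀ then 3 * x v else 0) - x v := by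
      intro v
      split_ifs <;> ring
    simp [hN, mulVec, dotProduct, this, Finset.sum_sub_distrib]
  have hrow' : ∀ x v, v ≠ v₀ → (N *ᵥ x) v = x v := fun x v hv => by
    have : N v = (1 : Matrix V V ℤ) v := by rw [hN, updateRow_ne hv]
    rw [mulVec, this]
    exact congrFun (one_mulVec x) v
  have hsum : ∀ x : V → ℤ, ∑ v, x v = x v₀ + ∑ v ∈ Finset.univ.erase v₀, x v := fun x =>
    (Finset.add_sum_erase _ _ (Finset.mem_univ _)).symm
  refine ⟨N, ?_, ?_⟩
  · have h := det_updateRow_sum (1 : Matrix V V ℤ) v₀ (fun v => if v = v₀ then 2 else -1)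
    have hlin : ∑ k, (if k = v₀ then (2 : ℤ) else -1) • (1 : Matrix V V ℤ) k =
        fun v => if v = v₀ then 2 else -1 := by
      ext x
      simp only [Finset.sum_apply, Pi.smul_apply, one_apply]
      simp
    rwa [hlin, if_pos rfl, det_one, smul_eq_mul, mul_one] at h
  · ext y
    constructor
    · rintro ⟨x, rfl⟩
      have hE : ∑ v ∈ Finset.univ.erase v₀, (N *ᵥ x) v = ∑ v ∈ Finset.univ.erase v₀, x v :=
        Finset.sum_congr rfl fun v hv => hrow' x v (Finset.ne_of_mem_erase hv)
      refine ⟨x v₀, ?_⟩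
      rw [hsum, hE, hrow, hsum x]
      ring
    · rintro ⟨k, hk⟩
      refine ⟨Function.update y v₀ k, ?_⟩
      ext v
      by_cases hv : v = v₀
      · subst hv
        have hE : ∑ w ∈ Finset.univ.erase v, Function.update y v k w =
            ∑ w ∈ Finset.univ.erase v, y w :=
          Finset.sum_congr rfl fun w hw => Function.update_of_ne (Finset.ne_of_mem_erase hw) _ _
        rw [hrow, hsum, hE, Function.update_self]
        have := hsum y
        linarith
      · rw [hrow' _ _ hv, Function.update_of_ne hv]

end

section

open Matrix

theorem mulVec_edgeIncMatrix {V : Type*} [Fintype V] [DecidableEq V] (G : SimpleGraph V)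
    [DecidableRel G.Adj] (l : G.edgeSet → ℤ) (v : V) :
    (edgeIncMatrix G *ᵥ l) v = ∑ e : G.edgeSet, if v ∈ (e : Sym2 V) then l e else 0 := by
  simp [edgeIncMatrix, mulVec, dotProduct]

theorem sum_sum_ite_mem_edgeSet {V R : Type*} [Fintype V] [DecidableEq V] [NonAssocSemiring R]
    (G : SimpleGraph V) [DecidableRel G.Adj] (l : G.edgeSet → R) :
    (∑ v, ∑ e : G.edgeSet, if v ∈ (e : Sym2 V) then l e else 0) = 2 * ∑ e, l e := by
  rw [Finset.sum_comm, Finset.mul_sum]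
  exact Finset.sum_congr rfl fun e _ => sum_ite_mem_sym2 (G.not_isDiag_of_mem_edgeSet e.2) _

theorem tiltedWeight_natCast_sub {d m l : ℕ} (hl : l ≤ d * m) :
    ((d * m - m).factorial : ℝ) / m.factorial * tiltedWeight d m ((l : ℤ) - m) =
      ((d * m - l).factorial : ℝ) / l.factorial *
        exp ((((l : ℤ) - m : ℤ) : ℝ) * (2 * (log (d * m) - 1) - rateSlope d)) := by
  have h1 : ((d * m - m).factorial : ℝ) ≠ 0 := by positivity
  have h2 : (m.factorial : ℝ) ≠ 0 := by positivity
  have h3 : (l : ℤ) ≤ d * m := by exact_mod_cast hl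
  rw [tiltedWeight, if_pos ⟨by omega, by linarith⟩]
  rw [show (m : ℤ) + (l - m) = l by ring, Int.toNat_natCast]
  field_simp

theorem sum_prod_factorial_eq_tsum {V : Type*} [Fintype V] [DecidableEq V] {G : SimpleGraph V}
    [DecidableRel G.Adj] {d : ℕ} (hreg : G.IsRegularOfDegree d) {r : ℕ}
    {B : Matrix G.edgeSet (Fin r) ℤ} {R : Matrix (Fin r) G.edgeSet ℤ}
    (hMB : edgeIncMatrix G * B = 0) (hRB : R * B = 1)
    (hBR : ∀ l, edgeIncMatrix G *ᵥ l = 0 → B *ᵥ (R *ᵥ l) = l) (m : ℕ) :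
    ∑ l ∈ Finset.univ.filter (fun l : G.edgeSet → Fin (d * m + 1) =>
        ∀ v, (∑ e : G.edgeSet, if v ∈ (e : Sym2 V) then (l e).val else 0) = d * m),
      ∏ e, ((d * m - (l e).val).factorial : ℝ) / (l e).val.factorial =
    (((d * m - m).factorial : ℝ) / m.factorial) ^ Fintype.card G.edgeSet *
      ∑' k : Fin r → ℤ, ∏ e, tiltedWeight d m ((B *ᵥ k) e) := by
  classical
  set s := Finset.univ.filter (fun l : G.edgeSet → Fin (d * m + 1) =>
        ∀ v, (∑ e : G.edgeSet, if v ∈ (e : Sym2 V) then (l e).val else 0) = d * m) with hs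
  let dev : (G.edgeSet → Fin (d * m + 1)) → G.edgeSet → ℤ := fun l e => (l e).val - m
  have hconst : ∀ v, (∑ e : G.edgeSet, if v ∈ (e : Sym2 V) then (m : ℤ) else 0) = d * m := by
    intro v
    rw [← Finset.sum_filter, Finset.sum_const, card_filter_mem_edgeSet, hreg.degree_eq v,
      nsmul_eq_mul]
  have hM : ∀ l, l ∈ s → edgeIncMatrix G *ᵥ dev l = 0 := by
    intro l hl
    ext v
    have h := (Finset.mem_filter.1 hl).2 v
    have hsub : ∀ e : G.edgeSet, (if v ∈ (e : Sym2 V) then dev l e else 0) =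
        (if v ∈ (e : Sym2 V) then ((l e).val : ℤ) else 0) -
          (if v ∈ (e : Sym2 V) then (m : ℤ) else 0) := by
      intro e
      split_ifs <;> simp [dev]
    rw [mulVec_edgeIncMatrix, Finset.sum_congr rfl fun e _ => hsub e, Finset.sum_sub_distrib,
      hconst, Pi.zero_apply, sub_eq_zero]
    exact_mod_cast h
  have hdev : ∀ l ∈ s, B *ᵥ (R *ᵥ dev l) = dev l := fun l hl => hBR _ (hM l hl)
  have hinj : Set.InjOn (fun l => R *ᵥ dev l) s := by
    intro l hl l' hl' h
    have h' : dev l = dev l' := by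
      rw [← hdev l hl, ← hdev l' hl']
      exact congrArg _ h
    ext e
    have := congrFun h' e
    simp only [dev] at this
    omega
  have hsupp : ∀ k ∉ s.image (fun l => R *ᵥ dev l), ∏ e, tiltedWeight d m ((B *ᵥ k) e) = 0 := by
    intro k hk
    by_contra hne
    refine hk (Finset.mem_image.2 ?_)
    have hrange : ∀ e, 0 ≤ (m : ℤ) + (B *ᵥ k) e ∧ (m : ℤ) + (B *ᵥ k) e ≤ d * m := by
      intro e
      by_contra hcon
      exact Finset.prod_ne_zero_iff.1 hne e (Finset.mem_univ e) (by rw [tiltedWeight, if_neg hcon])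
    let l : G.edgeSet → Fin (d * m + 1) := fun e =>
      ⟨((m : ℤ) + (B *ᵥ k) e).toNat, by
        have := hrange e
        have h2 : ((d * m : ℕ) : ℤ) = d * m := by push_cast; ring
        omega⟩
    have hl : ∀ e, ((l e).val : ℤ) = m + (B *ᵥ k) e := fun e => Int.toNat_of_nonneg (hrange e).1
    refine ⟨l, Finset.mem_filter.2 ⟨Finset.mem_univ _, fun v => ?_⟩, ?_⟩
    · have h0 : (edgeIncMatrix G *ᵥ (B *ᵥ k)) v = 0 := by
        rw [mulVec_mulVec, hMB, zero_mulVec, Pi.zero_apply]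
      rw [mulVec_edgeIncMatrix] at h0
      have hadd : ∀ e : G.edgeSet, (if v ∈ (e : Sym2 V) then ((l e).val : ℤ) else 0) =
          (if v ∈ (e : Sym2 V) then (m : ℤ) else 0) +
            (if v ∈ (e : Sym2 V) then (B *ᵥ k) e else 0) := by
        intro e
        rw [hl]
        split_ifs <;> simp
      have h1 : (∑ e : G.edgeSet, if v ∈ (e : Sym2 V) then ((l e).val : ℤ) else 0) = d * m := by
        rw [Finset.sum_congr rfl fun e _ => hadd e, Finset.sum_add_distrib, hconst, h0, add_zero]
      exact_mod_cast h1
    · have : dev l = B *ᵥ k := by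
        ext e
        simp only [dev]
        rw [hl]
        ring
      simp only [this]
      rw [mulVec_mulVec, hRB, one_mulVec]
  rw [tsum_eq_sum hsupp, Finset.sum_image hinj, Finset.mul_sum]
  refine Finset.sum_congr rfl fun l hl => ?_
  have hsum0 : ∑ e, dev l e = 0 := by
    have h := sum_sum_ite_mem_edgeSet G (dev l)
    simp_rw [← mulVec_edgeIncMatrix, hM l hl] at h
    simpa using h.symm
  have hcast : ∑ e, ((dev l e : ℤ) : ℝ) = 0 := by exact_mod_cast hsum0
  rw [hdev l hl, ← Finset.card_univ, ← Finset.prod_const, ← Finset.prod_mul_distrib]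
  have hterm : ∀ e, ((d * m - m).factorial : ℝ) / m.factorial * tiltedWeight d m (dev l e) =
      ((d * m - (l e).val).factorial : ℝ) / (l e).val.factorial *
        exp ((dev l e : ℝ) * (2 * (log (d * m) - 1) - rateSlope d)) := fun e =>
    tiltedWeight_natCast_sub (Nat.lt_succ_iff.1 (l e).2)
  rw [Finset.prod_congr rfl fun e _ => hterm e, Finset.prod_mul_distrib, ← exp_sum,
    ← Finset.sum_mul, hcast, zero_mul, exp_zero, mul_one]

open Filter Topology in
theorem tendsto_tsum_prod_tiltedWeight {V : Type*} [Fintype V] [DecidableEq V] {G : SimpleGraph V}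
    [DecidableRel G.Adj] {d : ℕ} (hd : 3 ≤ d) (hreg : G.IsRegularOfDegree d) {r : ℕ}
    {B : Matrix G.edgeSet (Fin r) ℤ} {R : Matrix (Fin r) G.edgeSet ℤ}
    (hMB : edgeIncMatrix G * B = 0) (hRB : R * B = 1) :
    Tendsto (fun m : ℕ => (∑' k : Fin r → ℤ, ∏ e, tiltedWeight d m ((B *ᵥ k) e)) / √m ^ r) atTop
      (𝓝 (√π ^ r / √((((d : ℝ) - 2) / (2 * (d - 1))) ^ r * ((Bᵀ * B).det : ℤ)))) := by
  classical
  have hd' : (3 : ℝ) ≤ d := by exact_mod_cast hd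
  set β : ℝ := ((d : ℝ) - 2) / (2 * (d - 1)) with hβ
  have hβ0 : 0 < β := div_pos (by linarith) (by linarith)
  let Br : Matrix G.edgeSet (Fin r) ℝ := B.map (Int.cast : ℤ → ℝ)
  let Rr : Matrix (Fin r) G.edgeSet ℝ := R.map (Int.cast : ℤ → ℝ)
  have hcastv : ∀ (k : Fin r → ℤ) e, (((B *ᵥ k) e : ℤ) : ℝ) = (Br *ᵥ fun i => (k i : ℝ)) e := by
    intro k e
    simp [mulVec, dotProduct, Br]
  have hRBr : Rr * Br = 1 := by
    have := congrArg (fun X : Matrix (Fin r) (Fin r) ℤ => X.map (Int.castRingHom ℝ)) hRB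
    rwa [Matrix.map_mul, Matrix.map_one _ (map_zero _) (map_one _)] at this
  have hinj : Function.Injective Br.mulVec := by
    intro x y h
    have := congrArg (Rr *ᵥ ·) h
    simpa [mulVec_mulVec, hRBr] using this
  have hQ : (β • (Brᵀ * Br)).PosDef := by
    have := Matrix.PosDef.conjTranspose_mul_self Br hinj
    rw [conjTranspose_eq_transpose_of_trivial] at this
    exact this.smul hβ0
  have hdet : (β • (Brᵀ * Br)).det = β ^ r * ((Bᵀ * B).det : ℤ) := by
    have h1 : Brᵀ * Br = (Bᵀ * B).map (Int.castRingHom ℝ) := by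
      rw [Matrix.map_mul, transpose_map]
      rfl
    rw [det_smul, Fintype.card_fin, h1, ← RingHom.mapMatrix_apply, ← RingHom.map_det]
    rfl
  have hint := integral_exp_neg_posDef hQ
  rw [hdet, Fintype.card_fin] at hint
  rw [← hint]
  obtain ⟨C, c, hC, hc, hbound⟩ := exists_prod_tiltedWeight_le hd
    (fun v : V => Finset.univ.filter fun e : G.edgeSet => v ∈ (e : Sym2 V))
    (fun v => (card_filter_mem_edgeSet G v).trans (hreg.degree_eq v))
    (fun φ => by simpa only [Finset.sum_filter] using sum_sum_ite_mem_edgeSet G φ)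
  obtain ⟨K, hK0, hK⟩ : ∃ K : ℝ, 0 < K ∧
      ∀ x : Fin r → ℝ, ∑ i, x i ^ 2 ≤ K * ∑ e, (Br *ᵥ x) e ^ 2 := by
    refine ⟨∑ i, ∑ e, Rr i e ^ 2 + 1, by positivity, fun x => ?_⟩
    have hx : x = Rr *ᵥ (Br *ᵥ x) := by rw [mulVec_mulVec, hRBr, one_mulVec]
    calc ∑ i, x i ^ 2 = ∑ i, (∑ e, Rr i e * (Br *ᵥ x) e) ^ 2 := by
          conv_lhs => rw [hx]
          rfl
      _ ≤ ∑ i, (∑ e, Rr i e ^ 2) * ∑ e, (Br *ᵥ x) e ^ 2 :=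
          Finset.sum_le_sum fun i _ => Finset.sum_mul_sq_le_sq_mul_sq _ _ _
      _ = (∑ i, ∑ e, Rr i e ^ 2) * ∑ e, (Br *ᵥ x) e ^ 2 := by rw [Finset.sum_mul]
      _ ≤ _ := by
          gcongr
          linarith
  have hB0 : ∀ k v, ∑ e ∈ Finset.univ.filter (fun e : G.edgeSet => v ∈ (e : Sym2 V)),
      (B *ᵥ k) e = 0 := by
    intro k v
    rw [Finset.sum_filter, ← mulVec_edgeIncMatrix, mulVec_mulVec, hMB, zero_mulVec, Pi.zero_apply]
  have := tendsto_tsum_div_sqrt_pow (ι := Fin r)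
    (F := fun m k => ∏ e, tiltedWeight d m ((B *ᵥ k) e))
    (φ := fun x => exp (-(x ⬝ᵥ (β • (Brᵀ * Br)) *ᵥ x))) hC.le (c := c / K) (by positivity) ?_ ?_
  · simpa using this
  · intro m hm k
    rw [abs_of_nonneg (Finset.prod_nonneg fun e _ => tiltedWeight_nonneg ..)]
    refine (hbound m _ hm (hB0 k)).trans ?_
    have h1 := hK fun i => (k i : ℝ)
    simp only [← hcastv] at h1
    have h2 : c / K * ∑ i, (k i : ℝ) ^ 2 / m ≤ c * ∑ e, (((B *ᵥ k) e : ℤ) : ℝ) ^ 2 / m := by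
      rw [← Finset.sum_div, ← Finset.sum_div, div_mul_eq_mul_div, div_le_iff₀ hK0, mul_assoc]
      gcongr
      rw [div_mul_eq_mul_div, mul_comm _ K]
      gcongr
    gcongr
  · intro x k hk
    have hquad : x ⬝ᵥ (β • (Brᵀ * Br)) *ᵥ x = ∑ e, β * (Br *ᵥ x) e ^ 2 := by
      rw [smul_mulVec, dotProduct_smul, ← mulVec_mulVec, dotProduct_mulVec, vecMul_transpose,
        smul_eq_mul, ← Finset.mul_sum]
      simp [dotProduct, sq]
    simp only [hquad]
    rw [← Finset.sum_neg_distrib, exp_sum]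
    refine tendsto_finsetProd _ fun e _ => tendsto_tiltedWeight hd ?_
    have heq : (fun m : ℕ => (((B *ᵥ k m) e : ℤ) : ℝ) / √m) =
        fun m : ℕ => ∑ i, Br e i * ((k m i : ℝ) / √m) := by
      funext m
      rw [hcastv, mulVec, dotProduct, Finset.sum_div]
      simp [mul_div_assoc]
    rw [heq]
    exact tendsto_finsetSum _ fun i _ => (hk i).const_mul _

end

section

open Filter Topology

open Matrix in
theorem det_transpose_mul_self_pos {E K : Type*} [Fintype E] [Fintype K] [DecidableEq K]
    {B : Matrix E K ℤ} {R : Matrix K E ℤ} (hRB : R * B = 1) : 0 < (Bᵀ * B).det := by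
  have hinj : Function.Injective (B.map (Int.castRingHom ℝ)).mulVec := by
    intro x y h
    have hR : R.map (Int.castRingHom ℝ) * B.map (Int.castRingHom ℝ) = 1 := by
      rw [← Matrix.map_mul, hRB, Matrix.map_one _ (map_zero _) (map_one _)]
    rw [← one_mulVec x, ← one_mulVec y, ← hR, ← mulVec_mulVec, ← mulVec_mulVec]
    exact congrArg _ h
  have h := (Matrix.PosDef.conjTranspose_mul_self _ hinj).det_pos
  rw [conjTranspose_eq_transpose_of_trivial, ← transpose_map, ← Matrix.map_mul,
    ← RingHom.mapMatrix_apply, ← RingHom.map_det] at h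
  exact Int.cast_pos.1 h

theorem tendsto_factorial_prefactor {d h r : ℕ} (hd : 3 ≤ d) (hdr : h * (d - 2) = d * r) :
    Tendsto (fun m : ℕ => ((d * m).factorial : ℝ)⁻¹ ^ r *
        (((d * m - m).factorial : ℝ) / m.factorial) ^ h * √m ^ r /
          exp (h * (d * m : ℕ) * edgeRate (1 / d))) atTop
      (𝓝 ((√(2 * π) * √d)⁻¹ ^ r * √((d : ℝ) - 1) ^ h)) := by
  have hd' : (3 : ℝ) ≤ d := by exact_mod_cast hd
  have hdr' : (h : ℝ) * (d - 2) = d * r := by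
    have := congrArg (Nat.cast : ℕ → ℝ) hdr
    rwa [Nat.cast_mul, Nat.cast_mul, Nat.cast_sub (by omega), Nat.cast_two] at this
  have hdm : Tendsto (fun m : ℕ => d * m) atTop atTop :=
    tendsto_id.const_mul_atTop' (by omega)
  have hdm' : Tendsto (fun m : ℕ => d * m - m) atTop atTop := by
    refine tendsto_atTop_mono (fun m => ?_) tendsto_id
    have := Nat.mul_le_mul_right m (show 2 ≤ d by omega)
    simp only [id]
    omega
  have hinv : Tendsto (fun m : ℕ => ((m : ℝ))⁻¹) atTop (𝓝 0) := tendsto_inv_atTop_nhds_zero_nat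
  have hsqrt : √(2 * π) ≠ 0 := by positivity
  have hA := (tendsto_stirlingRatio.comp hdm').div tendsto_stirlingRatio hsqrt
  have hB : Tendsto (fun m : ℕ => √(((d * m - m : ℕ) + 1 : ℝ) / (m + 1))) atTop
      (𝓝 √((d : ℝ) - 1)) := by
    refine (continuous_sqrt.tendsto _).comp ?_
    have h0 : Tendsto (fun m : ℕ => ((d : ℝ) - 1 + (m : ℝ)⁻¹) / (1 + (m : ℝ)⁻¹)) atTop
        (𝓝 (((d : ℝ) - 1 + 0) / (1 + 0))) :=
      (hinv.const_add _).div (hinv.const_add _) (by norm_num)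
    rw [add_zero, add_zero, div_one] at h0
    refine h0.congr' ?_
    filter_upwards [eventually_gt_atTop 0] with m hm
    have hm' : (0 : ℝ) < m := by exact_mod_cast hm
    rw [Nat.cast_sub (Nat.le_mul_of_pos_left m (by omega)), Nat.cast_mul]
    field_simp
  have hC : Tendsto (fun m : ℕ => √m / √((d * m : ℕ) + 1)) atTop (𝓝 (√d)⁻¹) := by
    have h0 : Tendsto (fun m : ℕ => √((d : ℝ) + (m : ℝ)⁻¹)⁻¹) atTop (𝓝 (√(d + 0)⁻¹)) :=
      (continuous_sqrt.tendsto _).comp ((hinv.const_add _).inv₀ (by positivity))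
    rw [add_zero, sqrt_inv] at h0
    refine h0.congr' ?_
    filter_upwards [eventually_gt_atTop 0] with m hm
    have hm' : (0 : ℝ) < m := by exact_mod_cast hm
    rw [← sqrt_div hm'.le, Nat.cast_mul]
    congr 1
    field_simp
  have hD := ((hC.div (tendsto_stirlingRatio.comp hdm) hsqrt).pow r).mul ((hA.mul hB).pow h)
  have hlim : ((√(d:ℝ))⁻¹ / √(2 * π)) ^ r * (√(2 * π) / √(2 * π) * √((d : ℝ) - 1)) ^ h =
      (√(2 * π) * √d)⁻¹ ^ r * √((d : ℝ) - 1) ^ h := by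
    rw [div_self hsqrt, one_mul, div_eq_mul_inv, mul_inv, mul_comm (√(d:ℝ))⁻¹]
  rw [hlim] at hD
  refine hD.congr' ?_
  filter_upwards [eventually_gt_atTop 0] with m hm
  have hm' : (0 : ℝ) < m := by exact_mod_cast hm
  have hn : 0 < d * m := by positivity
  have hml : m ≤ d * m := Nat.le_mul_of_pos_left m (by omega)
  have hs1 := stirlingRatio_pos (d * m)
  have hq : (m : ℝ) / (d * m : ℕ) = 1 / d := by
    rw [Nat.cast_mul]
    field_simp
  rw [factorial_sub_div_factorial hn hml, factorial_eq_stirlingRatio_mul (d * m), hq]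
  simp only [Function.comp, Pi.div_apply]
  set L := log ((d * m : ℕ) : ℝ) with hL
  have hexp : (exp ((d * m : ℕ) * L - (d * m : ℕ)))⁻¹ ^ r *
      exp ((d * m : ℕ) * edgeRate (1 / d) + ((d * m : ℕ) - 2 * m) * (L - 1)) ^ h /
        exp (h * (d * m : ℕ) * edgeRate (1 / d)) = 1 := by
    rw [← exp_neg, ← exp_nat_mul, ← exp_nat_mul, ← exp_add, ← exp_sub, exp_eq_one_iff]
    push_cast
    linear_combination m * (L - 1) * hdr'
  refine ((mul_one _).symm.trans (congrArg _ hexp.symm)).trans ?_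
  rw [Nat.cast_sub hml]
  simp only [mul_pow, mul_inv, div_eq_mul_inv]
  ring

theorem exp_mul_edgeRate_inv {d : ℕ} (hd : 3 ≤ d) (x : ℝ) :
    exp (d * x * edgeRate (1 / d)) = (((d : ℝ) - 1) ^ (d - 1) / (d : ℝ) ^ (d - 2)) ^ x := by
  have hd' : (3 : ℝ) ≤ d := by exact_mod_cast hd
  have h1 : (0 : ℝ) < d - 1 := by linarith
  have h0 : (0 : ℝ) < d := by linarith
  rw [rpow_def_of_pos (by positivity), log_div (by positivity) (by positivity), log_pow, log_pow,
    Nat.cast_sub (by omega), Nat.cast_sub (by omega), edgeRate, negMulLog, negMulLog,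
    show (1 : ℝ) - 1 / d = (d - 1) / d by field_simp, log_div h1.ne' h0.ne', one_div, log_inv]
  congr 1
  push_cast
  field_simp
  ring

theorem asymptotic_constant_eq {d g h r : ℕ} (hd : 3 ≤ d) (hdg : 2 * h = d * g) (hr : h = g + r)
    {D : ℝ} (hD : 0 < D) :
    (√(2 * π) * √d)⁻¹ ^ r * √((d : ℝ) - 1) ^ h *
        (√π ^ r / √((((d : ℝ) - 2) / (2 * (d - 1))) ^ r * D)) =
      2 * ((d : ℝ) - 1) ^ (((d : ℝ) - 1) * g / 2) /
        (((d : ℝ) * ((d : ℝ) - 2)) ^ ((d : ℝ) * g / 4 - (g : ℝ) / 2) * √(2 ^ 2 * D)) := by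
  have hd' : (3 : ℝ) ≤ d := by exact_mod_cast hd
  have h2 : (0 : ℝ) < d - 2 := by linarith
  have h1 : (0 : ℝ) < d - 1 := by linarith
  have h0 : (0 : ℝ) < d := by linarith
  have hdg' : 2 * (h : ℝ) = d * g := by exact_mod_cast hdg
  have hr' : (h : ℝ) = g + r := by exact_mod_cast hr
  have e1 : ((d : ℝ) - 1) * g / 2 = 1 / 2 * (h + r : ℕ) := by
    push_cast
    linarith
  have e2 : (d : ℝ) * g / 4 - (g : ℝ) / 2 = 1 / 2 * r := by linarith
  have hpow : ∀ (x : ℝ) (k : ℕ), 0 < x → √(x ^ k) = √x ^ k := fun x k hx => by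
    rw [sqrt_eq_rpow, sqrt_eq_rpow, ← rpow_natCast, ← rpow_natCast, ← rpow_mul hx.le,
      ← rpow_mul hx.le, mul_comm]
  rw [e1, e2, rpow_mul h1.le, rpow_mul (by positivity), ← sqrt_eq_rpow, ← sqrt_eq_rpow,
    rpow_natCast, rpow_natCast, sqrt_mul (by positivity), sqrt_mul (by positivity),
    sqrt_mul (by positivity) D, sqrt_sq (by positivity), hpow _ _ (div_pos h2 (by positivity)),
    sqrt_div (by positivity), sqrt_mul (by positivity), sqrt_mul (by positivity), pow_add]
  have p0 : 0 < √(d : ℝ) := sqrt_pos.2 h0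
  have p1 : 0 < √((d : ℝ) - 1) := sqrt_pos.2 h1
  have p2 : 0 < √((d : ℝ) - 2) := sqrt_pos.2 h2
  have p3 : 0 < √π := sqrt_pos.2 pi_pos
  have p4 : 0 < √D := sqrt_pos.2 hD
  simp only [mul_pow, div_pow, inv_pow, mul_inv]
  field_simp

end

open Filter Topology in
theorem isEquivalent_sum_prod_factorial {V : Type*} [Fintype V] [DecidableEq V]
    {G : SimpleGraph V} [DecidableRel G.Adj] {d g h : ℕ} (hd : 3 ≤ d)
    (hreg : G.IsRegularOfDegree d) (hconn : G.Connected) (hnb : ¬ G.Colorable 2)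
    (hg : Fintype.card V = g) (hh : Fintype.card G.edgeSet = h) (hdg : 2 * h = d * g) :
    Asymptotics.IsEquivalent atTop
      (fun m : ℕ => ((d * m).factorial : ℝ) ^ ((g : ℤ) - (h : ℤ)) *
        ∑ l ∈ Finset.univ.filter (fun l : G.edgeSet → Fin (d * m + 1) =>
            ∀ v, (∑ e : G.edgeSet, if v ∈ (e : Sym2 V) then (l e).val else 0) = d * m),
          ∏ e, ((d * m - (l e).val).factorial : ℝ) / (l e).val.factorial)
      (fun m : ℕ => 2 * ((d : ℝ) - 1) ^ (((d : ℝ) - 1) * g / 2) /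
          (((d : ℝ) * ((d : ℝ) - 2)) ^ ((d : ℝ) * g / 4 - (g : ℝ) / 2) *
            √(Matrix.det (G.adjMatrix ℝ + (d : ℝ) • (1 : Matrix V V ℝ)))) *
        ((((d : ℝ) - 1) ^ (d - 1) / (d : ℝ) ^ (d - 2)) ^ ((g : ℝ) * (d * m : ℕ) / 2))) := by
  have := hconn.nonempty
  obtain ⟨N, hN, hNrange⟩ := exists_range_mulVec_eq_even (V := V)
  obtain ⟨r, B, R, hcard, hMB, hRB, hBR, hdet⟩ := exists_kernel_lattice (M := edgeIncMatrix G)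
    (N := N) (by rw [hN]; norm_num) ((range_edgeIncMatrix hconn hnb).trans hNrange.symm)
  rw [hh, hg] at hcard
  have hDpos := det_transpose_mul_self_pos hRB
  set D : ℤ := (B.transpose * B).det with hD
  have hdetA : Matrix.det (G.adjMatrix ℝ + (d : ℝ) • (1 : Matrix V V ℝ)) = 2 ^ 2 * (D : ℝ) := by
    have hmap : G.adjMatrix ℝ + (d : ℝ) • (1 : Matrix V V ℝ) =
        (G.adjMatrix ℤ + (d : ℤ) • (1 : Matrix V V ℤ)).map (Int.castRingHom ℝ) := by
      ext v w
      simp only [Matrix.map_apply, Matrix.add_apply, Matrix.smul_apply,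
        SimpleGraph.adjMatrix_apply, Matrix.one_apply]
      split_ifs <;> simp
    rw [hmap, ← RingHom.mapMatrix_apply, ← RingHom.map_det,
      ← edgeIncMatrix_mul_transpose G hreg, hdet, hN, map_mul, map_pow]
    rfl
  have hdr : h * (d - 2) = d * r := by
    obtain ⟨k, rfl⟩ : ∃ k, d = k + 2 := ⟨d - 2, by omega⟩
    rw [Nat.add_sub_cancel]
    nlinarith
  have hlim := (tendsto_factorial_prefactor hd hdr).mul
    (tendsto_tsum_prod_tiltedWeight hd hreg hMB hRB)
  rw [← hD, asymptotic_constant_eq hd hdg hcard (Int.cast_pos.2 hDpos), ← hdetA] at hlim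
  have hd' : (3 : ℝ) ≤ d := by exact_mod_cast hd
  set c := 2 * ((d : ℝ) - 1) ^ (((d : ℝ) - 1) * g / 2) /
          (((d : ℝ) * ((d : ℝ) - 2)) ^ ((d : ℝ) * g / 4 - (g : ℝ) / 2) *
            √(Matrix.det (G.adjMatrix ℝ + (d : ℝ) • (1 : Matrix V V ℝ)))) with hc
  have hc0 : c ≠ 0 := by
    have h0 : (0 : ℝ) < d := by linarith
    have h1 : (0 : ℝ) < d - 1 := by linarith
    have h2 : (0 : ℝ) < d - 2 := by linarith
    have h3 : (0 : ℝ) < D := Int.cast_pos.2 hDpos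
    rw [hc, hdetA]
    positivity
  refine (((Asymptotics.isEquivalent_const_iff_tendsto hc0).2 hlim).mul
    (Asymptotics.IsEquivalent.refl (u := fun m : ℕ => exp (h * (d * m : ℕ) * edgeRate (1 / d))))
    ).congr_left ?_ |>.congr_right ?_
  · filter_upwards [eventually_gt_atTop 0] with m hm
    have hm' : (0 : ℝ) < m := by exact_mod_cast hm
    have hsqrt : √(m : ℝ) ≠ 0 := by positivity
    simp only [Pi.mul_apply]
    rw [sum_prod_factorial_eq_tsum hreg hMB hRB hBR, hh,
      show (g : ℤ) - h = -(r : ℤ) by rw [hcard]; push_cast; ring, zpow_neg, zpow_natCast, inv_pow]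
    field_simp
  · refine Eventually.of_forall fun m => ?_
    simp only [Pi.mul_apply]
    have hdg' : 2 * (h : ℝ) = d * g := by exact_mod_cast hdg
    have hexp : (h : ℝ) * (d * m : ℕ) * edgeRate (1 / d) =
        d * (g * (d * m : ℕ) / 2) * edgeRate (1 / d) := by
      linear_combination ((d * m : ℕ) : ℝ) / 2 * edgeRate (1 / d) * hdg'
    rw [hexp, exp_mul_edgeRate_inv hd, Function.const_apply]

end

open Nat in
open Classical in
/-- Let `G` be a finite connected non-bipartite `d`-regular simple graph
(`d ≥ 3`) with `g` vertices and `h = dg/2` edges and adjacency matrix `A`, and for `n ≥ 1`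
let `S n = ∑_ℓ n!^{g−h} ∏_e (n−ℓ_e)!/ℓ_e!`, the sum over integer vectors `0 ≤ ℓ_e ≤ n`
with `∑_{e∋v} ℓ_e = n` for all vertices `v`.  Then, as `n → ∞` along multiples of `d`,
`S n ∼ [2(d−1)^{(d−1)g/2}/((d(d−2))^{dg/4−g/2}·det(A+dI)^{1/2})]·((d−1)^{d−1}/d^{d−2})^{gn/2}`. -/
theorem stmt_8 {V : Type*} [Fintype V] [DecidableEq V] (G : SimpleGraph V)
    [DecidableRel G.Adj] (d g h : ℕ) (hd : 3 ≤ d)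
    (hreg : G.IsRegularOfDegree d)
    (hconn : G.Connected) (hnb : ¬ G.Colorable 2)
    (hg : Fintype.card V = g) (hh : Fintype.card G.edgeSet = h) (hdg : 2 * h = d * g)
    (S : ℕ → ℝ)
    (hS : ∀ n : ℕ, S n =
      ∑ ℓ ∈ Finset.univ.filter (fun ℓ : G.edgeSet → Fin (n + 1) =>
          ∀ v : V, (∑ e : G.edgeSet, if v ∈ (e : Sym2 V) then (ℓ e).val else 0) = n),
        (n ! : ℝ) ^ ((g : ℤ) - (h : ℤ)) *
          ∏ e : G.edgeSet, ((n - (ℓ e).val)! : ℝ) / (((ℓ e).val)! : ℝ)) :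
    Asymptotics.IsEquivalent (Filter.atTop ⊓ Filter.principal {n : ℕ | d ∣ n}) S
      (fun n =>
        2 * ((d:ℝ) - 1) ^ (((d:ℝ) - 1) * g / 2) /
          (((d:ℝ) * ((d:ℝ) - 2)) ^ ((d:ℝ) * g / 4 - (g:ℝ) / 2) *
            Real.sqrt (Matrix.det (G.adjMatrix ℝ + (d:ℝ) • (1 : Matrix V V ℝ)))) *
        ((((d:ℝ) - 1) ^ (d - 1) / (d:ℝ) ^ (d - 2)) ^ ((g:ℝ) * n / 2))) := by
  rw [show Filter.atTop ⊓ Filter.principal {n : ℕ | d ∣ n} =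
      Filter.map (fun m : ℕ => d * m) Filter.atTop from ?_]
  · rw [Asymptotics.IsEquivalent, Asymptotics.isLittleO_map]
    have hmain := isEquivalent_sum_prod_factorial hd hreg hconn hnb hg hh hdg
    refine (hmain.congr_left (Filter.Eventually.of_forall fun m => ?_)).isLittleO
    simp only [hS, Finset.mul_sum]
  · have hrange : {n : ℕ | d ∣ n} = Set.range fun m : ℕ => d * m :=
      Set.ext fun n => exists_congr fun m => eq_comm
    rw [hrange, ← Filter.map_comap, Filter.comap_embedding_atTop]
    · exact fun _ _ => Nat.mul_le_mul_left_iff (by omega)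
    · exact fun n => ⟨n, Nat.le_mul_of_pos_left n (by omega)⟩
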